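/- Let T be a compact Hausdorff space, N ≥ 1, 0 ≤ δ < ρ ≤ 1, and let σ : T × ℝ^N × ℝ^N → ℂ be a continuous family with values in S^0_{ρ,δ}(ℝ^N × ℝ^N) such that there is a fixed compact set K₀ ⊆ ℝ^N with σ(t,x,ξ) = 0 whenever x ∉ K₀. For each t ∈ T let A^t denote the bounded extension to L²(ℝ^N) of the operator A_{σ^t}. Then the map t ↦ A^t is continuous from T to the bounded operators on L²(ℝ^N) in the operator norm, and sup_{t ∈ T} ‖A^t‖ < ∞. (Corollary 5.3 ['Abdd'] of the paper.) -/

import Mathlib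

open MeasureTheory Filter

/-- Partial derivative of a symbol `a(x, θ)` in the `i`-th coordinate of the
spatial variable `x`. -/
noncomputable def pdX {n N : ℕ} (i : Fin n)
    (a : (Fin n → ℝ) → (Fin N → ℝ) → ℂ) : (Fin n → ℝ) → (Fin N → ℝ) → ℂ :=
  fun x θ => fderiv ℝ (fun x' => a x' θ) x (Pi.single i 1)

/-- Partial derivative of a symbol `a(x, θ)` in the `i`-th coordinate of the
frequency variable `θ`. -/
noncomputable def pdTheta {n N : ℕ} (i : Fin N)
    (a : (Fin n → ℝ) → (Fin N → ℝ) → ℂ) : (Fin n → ℝ) → (Fin N → ℝ) → ℂ :=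
  fun x θ => fderiv ℝ (fun θ' => a x θ') θ (Pi.single i 1)

/-- The iterated partial derivative `∂^α_θ ∂^β_x a` of a symbol, where the multi-indices
`α`, `β` are recorded as lists `Lθ`, `Lx` of coordinate directions (the length of the list
is the total order `|α|`, resp. `|β|`, of the multi-index). -/
noncomputable def symbolDeriv {n N : ℕ} (Lx : List (Fin n)) (Lθ : List (Fin N))
    (a : (Fin n → ℝ) → (Fin N → ℝ) → ℂ) : (Fin n → ℝ) → (Fin N → ℝ) → ℂ :=
  Lx.foldr pdX (Lθ.foldr pdTheta a)

/-- The japanese-bracket weight `⟨θ⟩^s = (1 + |θ|²)^(s/2)`. -/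
noncomputable def jweight {N : ℕ} (s : ℝ) (θ : Fin N → ℝ) : ℝ :=
  (1 + ‖θ‖ ^ 2) ^ (s / 2 : ℝ)

/-- The Hörmander class `S^m_{ρ,δ}(W × ℝ^N)`: `a` is smooth on `W × ℝ^N` and every iterated
derivative `∂^α_θ ∂^β_x a` is bounded on `K × ℝ^N` (`K ⊆ W` compact) by a constant times
`⟨θ⟩^(m - ρ|α| + δ|β|)`. -/
def IsHormanderSymbol {n N : ℕ} (ρ δ m : ℝ) (W : Set (Fin n → ℝ))
    (a : (Fin n → ℝ) → (Fin N → ℝ) → ℂ) : Prop :=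
  ContDiffOn ℝ (⊤ : ℕ∞) (fun p : (Fin n → ℝ) × (Fin N → ℝ) => a p.1 p.2) (W ×ˢ Set.univ) ∧
  ∀ K : Set (Fin n → ℝ), K ⊆ W → IsCompact K →
    ∀ (Lx : List (Fin n)) (Lθ : List (Fin N)), ∃ C : ℝ, 0 ≤ C ∧
      ∀ x ∈ K, ∀ θ : Fin N → ℝ,
        ‖symbolDeriv Lx Lθ a x θ‖ ≤
          C * jweight (m - ρ * (Lθ.length : ℝ) + δ * (Lx.length : ℝ)) θ

/-- A continuous family over `T` with values in `S^m_{ρ,δ}(W × ℝ^N)` : each `a t` lies in the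
class, and `t ↦ a t` is continuous for the Fréchet seminorm topology, i.e. for each `t₀`,
compact `K ⊆ W` and multi-indices, the corresponding seminorm of `a t - a t₀` is eventually
smaller than any `ε > 0`. -/
def IsContinuousSymbolFamily {T : Type*} [TopologicalSpace T] {n N : ℕ}
    (ρ δ m : ℝ) (W : Set (Fin n → ℝ))
    (a : T → (Fin n → ℝ) → (Fin N → ℝ) → ℂ) : Prop :=
  (∀ t, IsHormanderSymbol ρ δ m W (a t)) ∧
  ∀ t₀ : T, ∀ K : Set (Fin n → ℝ), K ⊆ W → IsCompact K →
    ∀ (Lx : List (Fin n)) (Lθ : List (Fin N)), ∀ ε : ℝ, 0 < ε →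
      ∀ᶠ t in nhds t₀, ∀ x ∈ K, ∀ θ : Fin N → ℝ,
        ‖symbolDeriv Lx Lθ (fun x' θ' => a t x' θ' - a t₀ x' θ') x θ‖ ≤
          ε * jweight (m - ρ * (Lθ.length : ℝ) + δ * (Lx.length : ℝ)) θ

/-- The dot product `x · ξ = ∑ i, x i * ξ i` on `ℝ^N`. -/
noncomputable def dotProd {N : ℕ} (x ξ : Fin N → ℝ) : ℝ := ∑ i, x i * ξ i

/-- The Fourier transform `𝓕 f (ξ) = ∫ e^{-2πi y·ξ} f(y) dy`. -/
noncomputable def fourierT {N : ℕ} (f : (Fin N → ℝ) → ℂ) (ξ : Fin N → ℝ) : ℂ :=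
  ∫ y : Fin N → ℝ, Complex.exp (-(2 * (Real.pi : ℂ) * Complex.I * (dotProd y ξ : ℂ))) * f y

/-- The pseudodifferential operator with symbol `σ`:
`A_σ f (x) = ∫ e^{2πi x·ξ} σ(x,ξ) 𝓕f(ξ) dξ`. -/
noncomputable def pdoApply {N : ℕ} (σ : (Fin N → ℝ) → (Fin N → ℝ) → ℂ)
    (f : (Fin N → ℝ) → ℂ) (x : Fin N → ℝ) : ℂ :=
  ∫ ξ : Fin N → ℝ,
    Complex.exp (2 * (Real.pi : ℂ) * Complex.I * (dotProd x ξ : ℂ)) * σ x ξ * fourierT f ξ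

open scoped FourierTransform ENNReal ContDiff

section Plancherel

variable {E : Type*} [NormedAddCommGroup E] [InnerProductSpace ℝ E] [FiniteDimensional ℝ E]
  [MeasurableSpace E] [BorelSpace E]

/-- On `L¹ ∩ L²` the Fourier integral agrees with the `L²` Fourier transform. -/
theorem fourier_toLp_ae_eq {u : E → ℂ} (hu1 : Integrable u) (hu2 : MemLp u 2) :
    (𝓕 (hu2.toLp u) : Lp ℂ 2 (volume : Measure E)) =ᵐ[volume] 𝓕 u := by
  have hcont : Continuous (𝓕 u) :=
    VectorFourier.fourierIntegral_continuous Real.continuous_fourierChar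
      (by exact continuous_inner) hu1
  refine ae_eq_of_integral_contDiff_smul_eq
    ((Lp.memLp _).locallyIntegrable (by norm_num)) hcont.locallyIntegrable ?_
  intro g hg hgs
  let φ : SchwartzMap E ℂ :=
    (hgs.comp_left (g := ((↑) : ℝ → ℂ)) (by simp)).toSchwartzMap
      (Complex.ofRealCLM.contDiff.comp hg)
  have hφ : ∀ x, φ x = (g x : ℂ) := fun x => rfl
  have h1 := congrArg (fun T => T φ) (Lp.fourier_toTemperedDistribution_eq (hu2.toLp u))
  simp only [TemperedDistribution.fourier_apply, Lp.toTemperedDistribution_apply, hφ] at h1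
  have h2 : ∫ x, (𝓕 φ) x • (hu2.toLp u) x = ∫ x, (𝓕 φ) x • u x := by
    refine integral_congr_ae ?_
    filter_upwards [hu2.coeFn_toLp] with x hx
    rw [hx]
  have h3 : ∫ x, (𝓕 (φ : E → ℂ)) x • u x = ∫ x, φ x • (𝓕 u) x := by
    have := VectorFourier.integral_fourierIntegral_smul_eq_flip (μ := volume) (ν := volume)
      (L := innerₗ E) Real.continuous_fourierChar (by exact continuous_inner) φ.integrable hu1
    rw [flip_innerₗ] at this
    exact this
  rw [h2, SchwartzMap.fourier_coe, h3] at h1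
  simpa [hφ, Complex.real_smul] using h1.symm

theorem eLpNorm_fourier_eq {u : E → ℂ} (hu1 : Integrable u) (hu2 : MemLp u 2) :
    eLpNorm (𝓕 u) 2 volume = eLpNorm u 2 volume := by
  rw [← eLpNorm_congr_ae (fourier_toLp_ae_eq hu1 hu2), ← eLpNorm_congr_ae hu2.coeFn_toLp]
  have h := Lp.norm_fourier_eq (hu2.toLp u)
  rw [Lp.norm_def, Lp.norm_def, ENNReal.toReal_eq_toReal_iff' (Lp.memLp _).2.ne
    (Lp.memLp _).2.ne] at h
  exact h

end Plancherel

section PiFourier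

variable {N : ℕ}

theorem fourierT_eq_fourier (u : (Fin N → ℝ) → ℂ) (ξ : Fin N → ℝ) :
    fourierT u ξ =
      𝓕 (fun v : EuclideanSpace ℝ (Fin N) => u (WithLp.ofLp v)) (WithLp.toLp 2 ξ) := by
  rw [Real.fourier_eq', fourierT,
    ← (PiLp.volume_preserving_ofLp (Fin N)).integral_comp
      (MeasurableEquiv.toLp 2 (Fin N → ℝ)).symm.measurableEmbedding]
  refine integral_congr_ae (Eventually.of_forall fun v => ?_)
  simp only [dotProd, smul_eq_mul, EuclideanSpace.inner_eq_star_dotProduct, dotProduct]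
  congr 2
  push_cast
  simp only [star_trivial, mul_comm (Complex.ofReal (ξ _))]
  ring

/-- Plancherel's identity for functions in `L¹ ∩ L²`. -/
theorem eLpNorm_fourierT {u : (Fin N → ℝ) → ℂ} (hu1 : Integrable u) (hu2 : MemLp u 2) :
    eLpNorm (fourierT u) 2 volume = eLpNorm u 2 volume := by
  have hO := PiLp.volume_preserving_ofLp (Fin N)
  have hT := PiLp.volume_preserving_toLp (Fin N)
  have he := (MeasurableEquiv.toLp 2 (Fin N → ℝ)).symm.measurableEmbedding
  have h1 : Integrable (u ∘ (WithLp.ofLp (p := 2))) := hO.integrable_comp_of_integrable hu1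
  have h2 : MemLp (u ∘ (WithLp.ofLp (p := 2))) 2 := hu2.comp_measurePreserving hO
  have h3 : fourierT u = 𝓕 (u ∘ (WithLp.ofLp (p := 2))) ∘ WithLp.toLp 2 :=
    funext fun ξ => fourierT_eq_fourier u ξ
  have hcont : Continuous (𝓕 (u ∘ (WithLp.ofLp (p := 2)))) :=
    VectorFourier.fourierIntegral_continuous Real.continuous_fourierChar
      (by exact continuous_inner) h1
  rw [h3, eLpNorm_comp_measurePreserving hcont.aestronglyMeasurable hT,
    eLpNorm_fourier_eq h1 h2, eLpNorm_comp_measurePreserving hu2.1 hO]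

theorem integrable_fourierT (f : SchwartzMap (Fin N → ℝ) ℂ) : Integrable (fourierT f) := by
  let φ : SchwartzMap (EuclideanSpace ℝ (Fin N)) ℂ :=
    SchwartzMap.compCLMOfContinuousLinearEquiv ℝ (EuclideanSpace.equiv (Fin N) ℝ) f
  have h3 : fourierT f =
      ⇑(𝓕 φ : SchwartzMap (EuclideanSpace ℝ (Fin N)) ℂ) ∘ WithLp.toLp 2 := by
    funext ξ
    rw [fourierT_eq_fourier, Function.comp_apply, SchwartzMap.fourier_coe]
    rfl
  rw [h3]
  exact (PiLp.volume_preserving_toLp (Fin N)).integrable_comp_of_integrable (𝓕 φ).integrable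

/-- The oscillatory integral `∫ e^{2πi x·ξ} a(x,ξ) F(ξ) dξ`. -/
noncomputable def oscInt (a : (Fin N → ℝ) → (Fin N → ℝ) → ℂ) (F : (Fin N → ℝ) → ℂ)
    (x : Fin N → ℝ) : ℂ :=
  ∫ ξ : Fin N → ℝ,
    Complex.exp (2 * (Real.pi : ℂ) * Complex.I * (dotProd x ξ : ℂ)) * a x ξ * F ξ

theorem dotProd_comm (x y : Fin N → ℝ) : dotProd x y = dotProd y x := by
  simp [dotProd, mul_comm]

theorem dotProd_neg (x y : Fin N → ℝ) : dotProd x (-y) = -dotProd x y := by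
  simp [dotProd]

theorem dotProd_sub (x y z : Fin N → ℝ) : dotProd x (y - z) = dotProd x y - dotProd x z := by
  simp [dotProd, mul_sub]

theorem continuous_dotProd : Continuous fun p : (Fin N → ℝ) × (Fin N → ℝ) => dotProd p.1 p.2 := by
  unfold dotProd
  fun_prop

theorem norm_exp_dotProd (r : ℝ) : ‖Complex.exp (2 * (Real.pi : ℂ) * Complex.I * (r : ℂ))‖ = 1 := by
  rw [show 2 * (Real.pi : ℂ) * Complex.I * (r : ℂ) = ((2 * Real.pi * r : ℝ) : ℂ) * Complex.I by
    push_cast; ring]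
  exact Complex.norm_exp_ofReal_mul_I _

theorem norm_exp_neg_dotProd (r : ℝ) :
    ‖Complex.exp (-(2 * (Real.pi : ℂ) * Complex.I * (r : ℂ)))‖ = 1 := by
  have := norm_exp_dotProd (-r)
  push_cast at this
  rwa [mul_neg] at this

/-- Plancherel's identity for the inverse Fourier integral. -/
theorem eLpNorm_oscInt_one {F : (Fin N → ℝ) → ℂ} (hF1 : Integrable F) (hF2 : MemLp F 2) :
    eLpNorm (oscInt (fun _ _ => 1) F) 2 volume = eLpNorm F 2 volume := by
  have h : oscInt (fun _ _ => 1) F = fourierT F ∘ Neg.neg := by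
    funext x
    simp only [oscInt, fourierT, Function.comp_apply, dotProd_neg, mul_one]
    push_cast
    simp only [mul_neg, neg_neg, dotProd_comm x]
  have hm : AEStronglyMeasurable (fourierT F) volume := by
    have : StronglyMeasurable (Function.uncurry fun ξ y : Fin N → ℝ =>
        Complex.exp (-(2 * (Real.pi : ℂ) * Complex.I * (dotProd y ξ : ℂ)))) := by
      refine Continuous.stronglyMeasurable ?_
      have := continuous_dotProd (N := N)
      simp only [Function.uncurry_def]
      have h2 : Continuous fun p : (Fin N → ℝ) × (Fin N → ℝ) => dotProd p.2 p.1 :=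
        this.comp continuous_swap
      fun_prop
    have hF := hF1.1
    refine ⟨fourierT (hF.mk F), ?_, ?_⟩
    · exact StronglyMeasurable.integral_prod_right
        (this.mul (hF.stronglyMeasurable_mk.comp_measurable measurable_snd))
    · refine Eventually.of_forall fun ξ => ?_
      refine integral_congr_ae ?_
      filter_upwards [hF.ae_eq_mk] with y hy
      rw [hy]
  rw [h, eLpNorm_comp_measurePreserving hm (Measure.measurePreserving_neg volume),
    eLpNorm_fourierT hF1 hF2]

end PiFourier

section Scale

variable {N : ℕ}

/-- The japanese bracket `⟨ξ⟩ = (1 + |ξ|²)^(1/2)`. -/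
noncomputable def jap (ξ : Fin N → ℝ) : ℝ := √(1 + ‖ξ‖ ^ 2)

theorem one_le_jap (ξ : Fin N → ℝ) : 1 ≤ jap ξ := by
  rw [jap, Real.one_le_sqrt]
  nlinarith [sq_nonneg ‖ξ‖]

theorem jap_pos (ξ : Fin N → ℝ) : 0 < jap ξ := one_pos.trans_le (one_le_jap ξ)

theorem continuous_jap : Continuous (jap (N := N)) := by
  unfold jap
  fun_prop

theorem jweight_eq (s : ℝ) (ξ : Fin N → ℝ) : jweight s ξ = jap ξ ^ s := by
  rw [jweight, jap, Real.sqrt_eq_rpow, ← Real.rpow_mul (by positivity)]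
  congr 1
  ring

theorem jap_le_add (ξ c : Fin N → ℝ) : jap ξ ≤ jap c + ‖ξ - c‖ := by
  have h1 : ‖ξ‖ ≤ ‖c‖ + ‖ξ - c‖ := by
    simpa using norm_add_le c (ξ - c)
  have h2 : ‖c‖ ≤ jap c := Real.le_sqrt_of_sq_le (by linarith)
  have h3 : jap c ^ 2 = 1 + ‖c‖ ^ 2 := Real.sq_sqrt (by positivity)
  refine Real.sqrt_le_iff.2 ⟨add_nonneg (jap_pos c).le (norm_nonneg _), ?_⟩
  nlinarith [norm_nonneg ξ, norm_nonneg c, norm_nonneg (ξ - c)]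

/-- The length scale `⟨ξ⟩^p / 8`. -/
noncomputable def scale (p : ℝ) (ξ : Fin N → ℝ) : ℝ := jap ξ ^ p / 8

theorem scale_pos (p : ℝ) (ξ : Fin N → ℝ) : 0 < scale p ξ := by
  have := jap_pos ξ
  unfold scale
  positivity

theorem continuous_scale (p : ℝ) : Continuous (scale (N := N) p) := by
  unfold scale
  exact (continuous_jap.rpow_const fun ξ => Or.inl (jap_pos ξ).ne').div_const 8

theorem scale_le_add {p : ℝ} (hp0 : 0 ≤ p) (hp1 : p ≤ 1) (ξ c : Fin N → ℝ) :
    scale p ξ ≤ scale p c + ‖ξ - c‖ / 8 := by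
  have hc := jap_pos c
  have hc1 := one_le_jap c
  have hn := norm_nonneg (ξ - c)
  have h1 : jap ξ ^ p ≤ (jap c * (1 + ‖ξ - c‖ / jap c)) ^ p := by
    refine Real.rpow_le_rpow (jap_pos ξ).le ?_ hp0
    rw [mul_add, mul_one, mul_div_cancel₀ _ hc.ne']
    exact jap_le_add ξ c
  rw [Real.mul_rpow hc.le (by positivity)] at h1
  have h2 : (1 + ‖ξ - c‖ / jap c) ^ p ≤ 1 + p * (‖ξ - c‖ / jap c) :=
    rpow_one_add_le_one_add_mul_self (by linarith [show 0 ≤ ‖ξ - c‖ / jap c by positivity])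
      hp0 hp1
  have h3 : jap c ^ p ≤ jap c := by
    simpa using Real.rpow_le_rpow_of_exponent_le hc1 hp1
  have h4 : jap c ^ p * (p * (‖ξ - c‖ / jap c)) ≤ ‖ξ - c‖ := by
    calc jap c ^ p * (p * (‖ξ - c‖ / jap c)) ≤ jap c * (1 * (‖ξ - c‖ / jap c)) := by gcongr
      _ = ‖ξ - c‖ := by field_simp
  have h5 : jap c ^ p * (1 + ‖ξ - c‖ / jap c) ^ p ≤
      jap c ^ p * (1 + p * (‖ξ - c‖ / jap c)) := by gcongr
  unfold scale
  linarith

/-- The normalized indicator of the cube of centre `ξ` and radius `scale p ξ`, as a function of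
the point `c`. -/
noncomputable def window (p : ℝ) (c ξ : Fin N → ℝ) : ℝ :=
  Set.indicator (Metric.closedBall ξ (scale p ξ)) (fun _ => ((2 * scale p ξ) ^ N)⁻¹) c

theorem window_nonneg (p : ℝ) (c ξ : Fin N → ℝ) : 0 ≤ window p c ξ :=
  Set.indicator_nonneg (fun _ _ => by have := scale_pos p ξ; positivity) c

theorem measurable_window (p : ℝ) :
    Measurable fun q : (Fin N → ℝ) × (Fin N → ℝ) => window p q.1 q.2 := by
  have hs := continuous_scale (N := N) p
  have : (fun q : (Fin N → ℝ) × (Fin N → ℝ) => window p q.1 q.2) =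
      Set.indicator {q | dist q.1 q.2 ≤ scale p q.2} fun q => ((2 * scale p q.2) ^ N)⁻¹ := by
    funext q
    rfl
  rw [this]
  refine Measurable.indicator ?_ (measurableSet_le (by fun_prop)
    (hs.measurable.comp measurable_snd))
  exact (((hs.measurable.comp measurable_snd).const_mul 2).pow_const N).inv

theorem measurable_window_right (p : ℝ) (c : Fin N → ℝ) : Measurable fun ξ => window p c ξ :=
  (measurable_window p).of_uncurry_left

theorem integrable_window (p : ℝ) (ξ : Fin N → ℝ) : Integrable fun c => window p c ξ := by
  have h : IntegrableOn (fun _ : Fin N → ℝ => ((2 * scale p ξ) ^ N)⁻¹)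
      (Metric.closedBall ξ (scale p ξ)) :=
    integrableOn_const (isCompact_closedBall _ _).measure_lt_top.ne
  exact h.integrable_indicator Metric.isClosed_closedBall.measurableSet

theorem integral_window (p : ℝ) (ξ : Fin N → ℝ) : ∫ c, window p c ξ = 1 := by
  have hs := scale_pos p ξ
  unfold window
  rw [integral_indicator Metric.isClosed_closedBall.measurableSet, setIntegral_const,
    Measure.real, Real.volume_pi_closedBall _ hs.le, Fintype.card_fin,
    ENNReal.toReal_ofReal (by positivity), smul_eq_mul]
  exact mul_inv_cancel₀ (by positivity)

theorem norm_sub_le_of_window_ne_zero {p : ℝ} {c ξ : Fin N → ℝ} (h : window p c ξ ≠ 0) :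
    ‖ξ - c‖ ≤ scale p ξ := by
  have := Set.mem_of_indicator_ne_zero h
  rwa [Metric.mem_closedBall, dist_comm, dist_eq_norm] at this

theorem lintegral_scale_mul_window_sq_le {p : ℝ} (hp0 : 0 ≤ p) (hp1 : p ≤ 1) (ξ : Fin N → ℝ) :
    ∫⁻ c, ENNReal.ofReal (scale p c ^ N) * ENNReal.ofReal (window p c ξ) ^ 2 ≤ 1 := by
  have hs := scale_pos p ξ
  have h : ∀ c, ENNReal.ofReal (scale p c ^ N) * ENNReal.ofReal (window p c ξ) ^ 2 ≤
      ENNReal.ofReal (window p c ξ) := by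
    intro c
    by_cases hw : window p c ξ = 0
    · simp [hw]
    have h1 := norm_sub_le_of_window_ne_zero hw
    have h2 := scale_le_add hp0 hp1 c ξ
    rw [norm_sub_rev] at h2
    have h3 : window p c ξ = ((2 * scale p ξ) ^ N)⁻¹ :=
      Set.indicator_of_mem (Set.mem_of_indicator_ne_zero hw) _
    have h4 : scale p c ^ N ≤ (2 * scale p ξ) ^ N :=
      pow_le_pow_left₀ (scale_pos p c).le (by linarith) N
    rw [sq, ← mul_assoc, ← ENNReal.ofReal_mul (by have := scale_pos p c; positivity)]
    refine (mul_le_mul_left ?_ _).trans_eq (one_mul _)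
    rw [ENNReal.ofReal_le_one, h3, ← div_eq_mul_inv]
    exact div_le_one_of_le₀ h4 (by positivity)
  refine (lintegral_mono h).trans_eq ?_
  rw [← ofReal_integral_eq_lintegral_ofReal (integrable_window p ξ)
    (Eventually.of_forall fun c => window_nonneg p c ξ), integral_window, ENNReal.ofReal_one]

/-- The set of pairs `(c, η)` with `η` within four scale lengths from `c`. -/
def nearSet (p : ℝ) : Set ((Fin N → ℝ) × (Fin N → ℝ)) := {q | ‖q.2 - q.1‖ ≤ 4 * scale p q.1}

theorem measurableSet_nearSet (p : ℝ) : MeasurableSet (nearSet (N := N) p) :=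
  measurableSet_le (by fun_prop) (((continuous_scale p).measurable.comp measurable_fst).const_mul 4)

theorem lintegral_near_le {p : ℝ} (hp0 : 0 ≤ p) (hp1 : p ≤ 1) (η : Fin N → ℝ) :
    ∫⁻ c, (nearSet p).indicator (fun q => ENNReal.ofReal ((scale p q.1 ^ N)⁻¹)) (c, η) ≤
      ENNReal.ofReal (24 ^ N) := by
  have hs := scale_pos p η
  have h : ∀ c, (nearSet p).indicator (fun q => ENNReal.ofReal ((scale p q.1 ^ N)⁻¹)) (c, η) ≤
      (Metric.closedBall η (8 * scale p η)).indicator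
        (fun _ => ENNReal.ofReal (((2 / 3 * scale p η) ^ N)⁻¹)) c := by
    intro c
    by_cases hc : (c, η) ∈ nearSet p
    · have h1 : ‖η - c‖ ≤ 4 * scale p c := hc
      have h2 := scale_le_add hp0 hp1 c η
      have h3 := scale_le_add hp0 hp1 η c
      rw [norm_sub_rev] at h2
      rw [Set.indicator_of_mem hc, Set.indicator_of_mem]
      · refine ENNReal.ofReal_le_ofReal (inv_anti₀ (by positivity) ?_)
        exact pow_le_pow_left₀ (by positivity) (by linarith) N
      · rw [Metric.mem_closedBall, dist_comm, dist_eq_norm]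
        linarith
    · rw [Set.indicator_of_notMem hc]
      exact zero_le
  refine (lintegral_mono h).trans_eq ?_
  rw [lintegral_indicator Metric.isClosed_closedBall.measurableSet, setLIntegral_const,
    Real.volume_pi_closedBall _ (by positivity), Fintype.card_fin,
    ← ENNReal.ofReal_mul (by positivity)]
  congr 1
  rw [inv_mul_eq_div, ← div_pow]
  congr 1
  field_simp
  norm_num

end Scale

section Taylor

variable {N : ℕ}

theorem norm_sub_taylor_le {G : ℕ → ℝ → ℂ} (hG : ∀ j s, HasDerivAt (G j) (G (j + 1) s) s)
    {M : ℝ} (k : ℕ) (hM : ∀ s ∈ Set.Icc (0 : ℝ) 1, ‖G k s‖ ≤ M) :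
    ∀ s ∈ Set.Icc (0 : ℝ) 1,
      ‖G 0 s - ∑ j ∈ Finset.range k, ((s ^ j / j.factorial : ℝ) : ℂ) * G j 0‖ ≤ M := by
  induction k generalizing G with
  | zero => simpa using hM
  | succ k ih =>
    have ih' := ih (G := fun j => G (j + 1)) (fun j s => hG (j + 1) s) hM
    have hd : ∀ s, HasDerivAt
        (fun s : ℝ => G 0 s - ∑ j ∈ Finset.range (k + 1), ((s ^ j / j.factorial : ℝ) : ℂ) * G j 0)
        (G 1 s - ∑ j ∈ Finset.range k, ((s ^ j / j.factorial : ℝ) : ℂ) * G (j + 1) 0) s := by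
      intro s
      refine (hG 0 s).sub ?_
      simp_rw [Finset.sum_range_succ']
      have h0 : HasDerivAt (fun s : ℝ => ((s ^ 0 / (Nat.factorial 0) : ℝ) : ℂ) * G 0 0) 0 s := by
        simpa using hasDerivAt_const s (G 0 0)
      have := HasDerivAt.fun_sum (u := Finset.range k)
        (A := fun j (s : ℝ) => ((s ^ (j + 1) / (j + 1).factorial : ℝ) : ℂ) * G (j + 1) 0)
        (A' := fun j => ((s ^ j / j.factorial : ℝ) : ℂ) * G (j + 1) 0) (x := s) (by
          intro j _
          refine HasDerivAt.mul_const ?_ _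
          have h := ((hasDerivAt_pow (j + 1) s).div_const ((j + 1).factorial : ℝ)).ofReal_comp
          refine h.congr_deriv ?_
          rw [Nat.factorial_succ]
          congr 1
          push_cast
          field_simp)
      exact (this.fun_add h0).congr_deriv (add_zero _)
    intro s hs
    have hmv := norm_image_sub_le_of_norm_deriv_le_segment_01'
      (f := fun r : ℝ => (fun s : ℝ => G 0 s - ∑ j ∈ Finset.range (k + 1),
        ((s ^ j / j.factorial : ℝ) : ℂ) * G j 0) (r * s))
      (f' := fun r => (s : ℝ) • (G 1 (r * s) - ∑ j ∈ Finset.range k,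
        (((r * s) ^ j / j.factorial : ℝ) : ℂ) * G (j + 1) 0)) (C := M)
      (fun r _ => by
        have := (hd (r * s)).scomp r ((hasDerivAt_id r).mul_const s)
        simpa [Function.comp_def] using this.hasDerivWithinAt)
      (fun r hr => by
        rw [norm_smul, Real.norm_of_nonneg hs.1]
        refine (mul_le_of_le_one_left (norm_nonneg _) hs.2).trans (ih' (r * s) ⟨?_, ?_⟩)
        · exact mul_nonneg hr.1 hs.1
        · exact mul_le_one₀ hr.2.le hs.1 hs.2)
    simpa [Finset.sum_range_succ'] using hmv

variable {a : (Fin N → ℝ) → (Fin N → ℝ) → ℂ}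

theorem contDiff_foldr_pdTheta (ha : ContDiff ℝ ∞ (Function.uncurry a)) (L : List (Fin N)) :
    ContDiff ℝ ∞ (Function.uncurry (L.foldr pdTheta a)) := by
  induction L with
  | nil => exact ha
  | cons i L ih =>
    have h : ContDiff ℝ ∞ (fun q : (Fin N → ℝ) × (Fin N → ℝ) =>
        fderiv ℝ (fun θ => L.foldr pdTheta a q.1 θ) q.2) := by
      refine ContDiff.fderiv (m := ∞) (f := fun (q : (Fin N → ℝ) × (Fin N → ℝ)) θ =>
        L.foldr pdTheta a q.1 θ) ?_ contDiff_snd le_rfl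
      exact ih.comp ((contDiff_fst.comp contDiff_fst).prodMk contDiff_snd)
    exact h.clm_apply contDiff_const

theorem contDiff_foldr_pdX (ha : ContDiff ℝ ∞ (Function.uncurry a)) (L : List (Fin N)) :
    ContDiff ℝ ∞ (Function.uncurry (L.foldr pdX a)) := by
  induction L with
  | nil => exact ha
  | cons i L ih =>
    have h : ContDiff ℝ ∞ (fun q : (Fin N → ℝ) × (Fin N → ℝ) =>
        fderiv ℝ (fun x => L.foldr pdX a x q.2) q.1) := by
      refine ContDiff.fderiv (m := ∞) (f := fun (q : (Fin N → ℝ) × (Fin N → ℝ)) x =>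
        L.foldr pdX a x q.2) ?_ contDiff_fst le_rfl
      exact ih.comp (contDiff_snd.prodMk (contDiff_snd.comp contDiff_fst))
    exact h.clm_apply contDiff_const

/-- The derivative of order `j` of `s ↦ a(x, c + s h)`, expanded in coordinates. -/
noncomputable def dirDeriv (a : (Fin N → ℝ) → (Fin N → ℝ) → ℂ) (x c h : Fin N → ℝ) (j : ℕ)
    (s : ℝ) : ℂ :=
  ∑ L : Fin j → Fin N, ((∏ i, h (L i) : ℝ) : ℂ) * (List.ofFn L).foldr pdTheta a x (c + s • h)

theorem hasDerivAt_dirDeriv (ha : ContDiff ℝ ∞ (Function.uncurry a)) (x c h : Fin N → ℝ) (j : ℕ)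
    (s : ℝ) : HasDerivAt (dirDeriv a x c h j) (dirDeriv a x c h (j + 1) s) s := by
  have hD : ∀ L : List (Fin N), HasDerivAt (fun s : ℝ => L.foldr pdTheta a x (c + s • h))
      (∑ i, (h i : ℂ) * (i :: L).foldr pdTheta a x (c + s • h)) s := by
    intro L
    have h1 : DifferentiableAt ℝ (L.foldr pdTheta a x) (c + s • h) := by
      have : ContDiff ℝ ∞ (L.foldr pdTheta a x) :=
        (contDiff_foldr_pdTheta ha L).comp (contDiff_const.prodMk contDiff_id)
      exact this.differentiable (by simp) _
    have h2 : HasDerivAt (fun s : ℝ => c + s • h) h s := by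
      simpa using ((hasDerivAt_id s).smul_const h).const_add c
    have h3 := h1.hasFDerivAt.comp_hasDerivAt s h2
    refine h3.congr_deriv ?_
    have h4 := congrArg (fderiv ℝ (L.foldr pdTheta a x) (c + s • h)) (pi_eq_sum_univ' h)
    rw [map_sum] at h4
    refine h4.trans (Finset.sum_congr rfl fun i _ => ?_)
    rw [map_smul, Complex.real_smul]
    rfl
  have := HasDerivAt.fun_sum (u := (Finset.univ : Finset (Fin j → Fin N)))
    fun L _ => (hD (List.ofFn L)).const_mul ((∏ i, h (L i) : ℝ) : ℂ)
  refine this.congr_deriv (Eq.symm ?_)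
  unfold dirDeriv
  rw [← (Fin.consEquiv fun _ : Fin (j + 1) => Fin N).sum_comp, Fintype.sum_prod_type,
    Finset.sum_comm]
  refine Finset.sum_congr rfl fun L _ => ?_
  rw [Finset.mul_sum]
  refine Finset.sum_congr rfl fun i _ => ?_
  have hL : List.ofFn ((Fin.consEquiv fun _ : Fin (j + 1) => Fin N) (i, L)) = i :: List.ofFn L :=
    List.ofFn_cons i L
  rw [hL]
  simp only [Fin.consEquiv_apply, Fin.prod_univ_succ, Fin.cons_zero, Fin.cons_succ]
  push_cast
  ring

/-- Quantitative control of a symbol supported over `K`: bounds on the pure frequency and pure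
space derivatives up to order `k`. -/
structure SymbolBound (ρ δ B : ℝ) (k : ℕ) (K : Set (Fin N → ℝ))
    (a : (Fin N → ℝ) → (Fin N → ℝ) → ℂ) : Prop where
  nonneg : 0 ≤ B
  smooth : ContDiff ℝ ∞ (Function.uncurry a)
  supp : ∀ x ∉ K, ∀ ξ, a x ξ = 0
  bound_theta : ∀ L : List (Fin N), L.length ≤ k → ∀ x θ,
    ‖L.foldr pdTheta a x θ‖ ≤ B * jap θ ^ (-ρ * L.length)
  bound_x : ∀ L : List (Fin N), L.length ≤ k → ∀ x θ,
    ‖L.foldr pdX a x θ‖ ≤ B * jap θ ^ (δ * L.length)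

theorem foldr_pdTheta_eq_zero {x : Fin N → ℝ} (hx : ∀ ξ, a x ξ = 0) (L : List (Fin N))
    (ξ : Fin N → ℝ) : L.foldr pdTheta a x ξ = 0 := by
  induction L generalizing ξ with
  | nil => exact hx ξ
  | cons i L ih =>
    have : (fun θ => L.foldr pdTheta a x θ) = fun _ => 0 := funext ih
    simp [List.foldr_cons, pdTheta, this]

/-- The Taylor polynomial of order `k` at `c` of the symbol, in the frequency variable. -/
noncomputable def symbolTaylor (a : (Fin N → ℝ) → (Fin N → ℝ) → ℂ) (k : ℕ) (c : Fin N → ℝ)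
    (x ξ : Fin N → ℝ) : ℂ :=
  ∑ j ∈ Finset.range k, ∑ L : Fin j → Fin N,
    ((1 / j.factorial : ℝ) : ℂ) * (List.ofFn L).foldr pdTheta a x c *
      ((∏ i, (ξ - c) (L i) : ℝ) : ℂ)

theorem norm_prod_apply_le {h : Fin N → ℝ} {r : ℝ} (hr : ‖h‖ ≤ r) {j : ℕ} (L : Fin j → Fin N) :
    ‖((∏ i, h (L i) : ℝ) : ℂ)‖ ≤ r ^ j := by
  rw [Complex.norm_real, norm_prod]
  refine (Finset.prod_le_prod (fun _ _ => norm_nonneg _)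
    fun i _ => (norm_le_pi_norm h (L i)).trans hr).trans_eq (by simp)

theorem SymbolBound.norm_sub_symbolTaylor_le {ρ δ B : ℝ} {k : ℕ} {K : Set (Fin N → ℝ)}
    (ha : SymbolBound ρ δ B k K a) (hρ0 : 0 ≤ ρ) (hρ1 : ρ ≤ 1) {r : ℝ} (x : Fin N → ℝ)
    {c ξ : Fin N → ℝ} (hr : ‖ξ - c‖ ≤ r) (hrc : r ≤ jap c / 2) :
    ‖a x ξ - symbolTaylor a k c x ξ‖ ≤ (2 * N * r) ^ k * B * jap c ^ (-ρ * k) := by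
  have hr0 : 0 ≤ r := (norm_nonneg _).trans hr
  have hB := ha.nonneg
  have hjc := jap_pos c
  have key := norm_sub_taylor_le (fun j s => hasDerivAt_dirDeriv ha.smooth x c (ξ - c) j s)
    (M := (2 * N * r) ^ k * B * jap c ^ (-ρ * k)) k (by
      intro s hs
      set z := c + s • (ξ - c) with hz
      have hzc : ‖c - z‖ ≤ r := by
        rw [hz, sub_add_cancel_left, norm_neg, norm_smul, Real.norm_of_nonneg hs.1]
        exact (mul_le_of_le_one_left (norm_nonneg _) hs.2).trans hr
      have hj : jap c / 2 ≤ jap z := by linarith [jap_le_add c z]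
      have hw : jap z ^ (-ρ * k) ≤ 2 ^ k * jap c ^ (-ρ * k) := by
        have hneg : -ρ * k ≤ 0 := by
          have : 0 ≤ ρ * k := by positivity
          linarith
        refine (Real.rpow_le_rpow_of_nonpos (by positivity) hj hneg).trans ?_
        rw [Real.div_rpow hjc.le (by norm_num), div_eq_mul_inv, mul_comm,
          ← Real.rpow_neg (by norm_num)]
        refine mul_le_mul_of_nonneg_right ?_ (by positivity)
        rw [← Real.rpow_natCast 2 k]
        refine Real.rpow_le_rpow_of_exponent_le (by norm_num) ?_
        have : ρ * k ≤ 1 * k := by gcongr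
        linarith
      refine (norm_sum_le _ _).trans ?_
      have hterm : ∀ L ∈ (Finset.univ : Finset (Fin k → Fin N)),
          ‖((∏ i, (ξ - c) (L i) : ℝ) : ℂ) * (List.ofFn L).foldr pdTheta a x z‖ ≤
            r ^ k * (B * (2 ^ k * jap c ^ (-ρ * k))) := by
        intro L _
        rw [norm_mul]
        refine mul_le_mul (norm_prod_apply_le hr L) ?_ (norm_nonneg _) (by positivity)
        refine (ha.bound_theta _ (by simp) x z).trans ?_
        rw [List.length_ofFn]
        gcongr
      refine (Finset.sum_le_card_nsmul _ _ _ hterm).trans_eq ?_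
      simp only [Finset.card_univ, Fintype.card_fun, Fintype.card_fin, nsmul_eq_mul]
      push_cast
      ring) 1 ⟨zero_le_one, le_rfl⟩
  convert key using 3
  · simp [dirDeriv]
  · unfold symbolTaylor dirDeriv
    refine Finset.sum_congr rfl fun j _ => ?_
    rw [Finset.mul_sum]
    refine Finset.sum_congr rfl fun L _ => ?_
    simp only [one_pow, zero_smul, add_zero]
    ring

end Taylor

section Block

variable {N : ℕ} {a : (Fin N → ℝ) → (Fin N → ℝ) → ℂ}

theorem continuous_exp_dotProd : Continuous fun q : (Fin N → ℝ) × (Fin N → ℝ) =>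
    Complex.exp (2 * (Real.pi : ℂ) * Complex.I * (dotProd q.1 q.2 : ℂ)) := by
  have := continuous_dotProd (N := N)
  fun_prop

theorem aestronglyMeasurable_oscInt (ha : Continuous (Function.uncurry a))
    {F : (Fin N → ℝ) → ℂ} (hF : AEStronglyMeasurable F volume) :
    AEStronglyMeasurable (oscInt a F) volume :=
  AEStronglyMeasurable.integral_prod_right'
    (f := fun q : (Fin N → ℝ) × (Fin N → ℝ) =>
      Complex.exp (2 * (Real.pi : ℂ) * Complex.I * (dotProd q.1 q.2 : ℂ)) * a q.1 q.2 * F q.2)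
    (((continuous_exp_dotProd.mul ha).aestronglyMeasurable).mul hF.comp_snd)

theorem integrable_oscInt_integrand (ha : Continuous (Function.uncurry a)) {B : ℝ}
    (hB : ∀ x ξ, ‖a x ξ‖ ≤ B) {F : (Fin N → ℝ) → ℂ} (hF : Integrable F) (x : Fin N → ℝ) :
    Integrable fun ξ =>
      Complex.exp (2 * (Real.pi : ℂ) * Complex.I * (dotProd x ξ : ℂ)) * a x ξ * F ξ := by
  refine hF.bdd_mul (c := B) ?_ (Eventually.of_forall fun ξ => ?_)
  · exact ((continuous_exp_dotProd.mul ha).comp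
      (continuous_const.prodMk continuous_id)).aestronglyMeasurable
  · rw [norm_mul, norm_exp_dotProd, one_mul]
    exact hB x ξ

theorem SymbolBound.norm_le {ρ δ B : ℝ} {k : ℕ} {K : Set (Fin N → ℝ)}
    (ha : SymbolBound ρ δ B k K a) (x ξ : Fin N → ℝ) : ‖a x ξ‖ ≤ B := by
  simpa using ha.bound_theta [] (by simp) x ξ

theorem SymbolBound.continuous {ρ δ B : ℝ} {k : ℕ} {K : Set (Fin N → ℝ)}
    (ha : SymbolBound ρ δ B k K a) : Continuous (Function.uncurry a) :=
  ha.smooth.continuous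

theorem eLpNorm_one_le_of_support {c : Fin N → ℝ} {r : ℝ} (hr : 0 ≤ r) {F : (Fin N → ℝ) → ℂ}
    (hF : AEStronglyMeasurable F volume) (hFs : ∀ ξ, F ξ ≠ 0 → ‖ξ - c‖ ≤ r) :
    eLpNorm F 1 volume ≤ eLpNorm F 2 volume * ENNReal.ofReal ((2 * r) ^ N) ^ (1 / 2 : ℝ) := by
  have hsupp : Function.support F ⊆ Metric.closedBall c r := fun ξ hξ => by
    rw [Metric.mem_closedBall, dist_eq_norm]
    exact hFs ξ hξ
  have hm : MeasurableSet (Metric.closedBall c r) := Metric.isClosed_closedBall.measurableSet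
  have h := eLpNorm_le_eLpNorm_mul_rpow_measure_univ (p := 1) (q := 2)
    (μ := volume.restrict (Metric.closedBall c r)) (by norm_num) hF.restrict
  rw [Measure.restrict_apply_univ, Real.volume_pi_closedBall _ hr, Fintype.card_fin] at h
  rw [eLpNorm_restrict_eq_of_support_subset hsupp, eLpNorm_restrict_eq_of_support_subset hsupp] at h
  convert h using 3
  norm_num

/-- The constant in the `L²` bound on a single frequency block. -/
noncomputable def blockConst (N k : ℕ) (K : Set (Fin N → ℝ)) : ℝ :=
  ∑ j ∈ Finset.range k, (N : ℝ) ^ j + (N : ℝ) ^ k * (volume K).toReal ^ (1 / 2 : ℝ)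

theorem eLpNorm_oscInt_taylorTerm_le {ρ δ B p : ℝ} {k : ℕ} {K : Set (Fin N → ℝ)}
    (ha : SymbolBound ρ δ B k K a) (hpρ : p ≤ ρ) {c : Fin N → ℝ} {F : (Fin N → ℝ) → ℂ}
    (hF1 : Integrable F) (hF2 : MemLp F 2) (hFs : ∀ ξ, F ξ ≠ 0 → ‖ξ - c‖ ≤ jap c ^ p / 4)
    {j : ℕ} (hj : j < k) (L : Fin j → Fin N) :
    Integrable (fun ξ => ((∏ i, (ξ - c) (L i) : ℝ) : ℂ) * F ξ) ∧
    eLpNorm (fun x => ((1 / j.factorial : ℝ) : ℂ) * (List.ofFn L).foldr pdTheta a x c *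
      oscInt (fun _ _ => 1) (fun ξ => ((∏ i, (ξ - c) (L i) : ℝ) : ℂ) * F ξ) x) 2 volume ≤
      ENNReal.ofReal B * eLpNorm F 2 volume := by
  have hjc := jap_pos c
  have hB := ha.nonneg
  set r := jap c ^ p / 4 with hr
  have hr0 : 0 ≤ r := by positivity
  have hb : ∀ ξ, ‖((∏ i, (ξ - c) (L i) : ℝ) : ℂ) * F ξ‖ ≤ r ^ j * ‖F ξ‖ := by
    intro ξ
    by_cases h0 : F ξ = 0
    · simp [h0]
    rw [norm_mul]
    exact mul_le_mul_of_nonneg_right (norm_prod_apply_le (hFs ξ h0) L) (norm_nonneg _)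
  have hcont : Continuous fun ξ : Fin N → ℝ => ((∏ i, (ξ - c) (L i) : ℝ) : ℂ) := by
    simp only [Pi.sub_apply]
    fun_prop
  have hm := hcont.aestronglyMeasurable.mul hF1.1 (μ := volume)
  have hI : Integrable (fun ξ => ((∏ i, (ξ - c) (L i) : ℝ) : ℂ) * F ξ) :=
    (hF1.norm.const_mul (r ^ j)).mono' hm (Eventually.of_forall hb)
  have hL2 : MemLp (fun ξ => ((∏ i, (ξ - c) (L i) : ℝ) : ℂ) * F ξ) 2 :=
    (hF2.norm.const_mul (r ^ j)).mono hm (Eventually.of_forall fun ξ => by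
      rw [Real.norm_of_nonneg (by positivity)]; exact hb ξ)
  refine ⟨hI, ?_⟩
  have h1 := eLpNorm_le_mul_eLpNorm_of_ae_le_mul (μ := volume)
    (g := oscInt (fun _ _ => 1) (fun ξ => ((∏ i, (ξ - c) (L i) : ℝ) : ℂ) * F ξ))
    (f := fun x => ((1 / j.factorial : ℝ) : ℂ) * (List.ofFn L).foldr pdTheta a x c *
      oscInt (fun _ _ => 1) (fun ξ => ((∏ i, (ξ - c) (L i) : ℝ) : ℂ) * F ξ) x)
    (c := B * jap c ^ (-ρ * j)) (Eventually.of_forall fun x => by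
      rw [norm_mul, norm_mul, Complex.norm_real]
      refine mul_le_mul_of_nonneg_right ?_ (norm_nonneg _)
      have h2 := ha.bound_theta (List.ofFn L) (by simpa using hj.le) x c
      rw [List.length_ofFn] at h2
      refine (mul_le_of_le_one_left (norm_nonneg _) ?_).trans h2
      rw [Real.norm_of_nonneg (by positivity)]
      refine div_le_one_of_le₀ ?_ (by positivity)
      exact_mod_cast Nat.factorial_pos j) 2
  have h2 := eLpNorm_le_mul_eLpNorm_of_ae_le_mul (μ := volume) (g := F)
    (f := fun ξ => ((∏ i, (ξ - c) (L i) : ℝ) : ℂ) * F ξ) (Eventually.of_forall hb) 2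
  rw [eLpNorm_oscInt_one hI hL2] at h1
  refine h1.trans ((mul_le_mul_right h2 _).trans ?_)
  rw [← mul_assoc, ← ENNReal.ofReal_mul (by positivity)]
  refine mul_le_mul_left (ENNReal.ofReal_le_ofReal ?_) _
  have h3 : r ^ j ≤ jap c ^ (ρ * j) := by
    have : r ≤ jap c ^ ρ := by
      have := Real.rpow_le_rpow_of_exponent_le (one_le_jap c) hpρ
      have h0 : 0 < jap c ^ p := by positivity
      linarith
    rw [Real.rpow_mul hjc.le, Real.rpow_natCast]
    exact pow_le_pow_left₀ hr0 this j
  calc B * jap c ^ (-ρ * j) * r ^ j ≤ B * jap c ^ (-ρ * j) * jap c ^ (ρ * j) := by gcongr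
    _ = B := by
      rw [mul_assoc, ← Real.rpow_add hjc]
      simp

theorem eLpNorm_oscInt_remainder_le {ρ δ B p : ℝ} {k : ℕ} {K : Set (Fin N → ℝ)}
    (ha : SymbolBound ρ δ B k K a) (hK : IsCompact K) (hp0 : 0 ≤ p) (hpρ : p ≤ ρ) (hρ1 : ρ ≤ 1)
    (hk : N ≤ (ρ - p) * k) {c : Fin N → ℝ} {F : (Fin N → ℝ) → ℂ}
    (hF1 : Integrable F) (hFs : ∀ ξ, F ξ ≠ 0 → ‖ξ - c‖ ≤ jap c ^ p / 4) :
    eLpNorm (oscInt (fun x ξ => a x ξ - symbolTaylor a k c x ξ) F) 2 volume ≤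
      ENNReal.ofReal (B * ((N : ℝ) ^ k * (volume K).toReal ^ (1 / 2 : ℝ))) *
        eLpNorm F 2 volume := by
  have hjc := jap_pos c
  have hjc1 := one_le_jap c
  have hB := ha.nonneg
  set r := jap c ^ p / 4 with hr
  have hr0 : 0 ≤ r := by positivity
  have hjp : jap c ^ p ≤ jap c := by
    simpa using Real.rpow_le_rpow_of_exponent_le hjc1 (hpρ.trans hρ1)
  set D := (N : ℝ) ^ k * B * jap c ^ (-(N : ℝ)) with hD
  have hD0 : 0 ≤ D := by positivity
  have hR : ∀ x ξ, F ξ ≠ 0 → ‖a x ξ - symbolTaylor a k c x ξ‖ ≤ D := by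
    intro x ξ hξ
    refine (ha.norm_sub_symbolTaylor_le (hp0.trans hpρ) hρ1 x (hFs ξ hξ) (by linarith)).trans ?_
    have h1 : (2 * N * r) ^ k ≤ (N : ℝ) ^ k * jap c ^ (p * k) := by
      rw [Real.rpow_mul hjc.le, Real.rpow_natCast, ← mul_pow]
      refine pow_le_pow_left₀ (by positivity) ?_ k
      have : 0 ≤ (N : ℝ) * jap c ^ p := by positivity
      rw [hr]
      linarith
    calc (2 * N * r) ^ k * B * jap c ^ (-ρ * k)
        ≤ (N : ℝ) ^ k * jap c ^ (p * k) * B * jap c ^ (-ρ * k) := by gcongr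
      _ = (N : ℝ) ^ k * B * jap c ^ (p * k + -ρ * k) := by
        rw [Real.rpow_add hjc]; ring
      _ ≤ D := by
        rw [hD]
        refine mul_le_mul_of_nonneg_left ?_ (by positivity)
        exact Real.rpow_le_rpow_of_exponent_le hjc1 (by linarith)
  have hpt : ∀ x, ‖oscInt (fun x ξ => a x ξ - symbolTaylor a k c x ξ) F x‖ ≤
      ‖K.indicator (fun _ => D * ∫ ξ, ‖F ξ‖) x‖ := by
    intro x
    by_cases hx : x ∈ K
    · rw [Set.indicator_of_mem hx,
        Real.norm_of_nonneg (mul_nonneg hD0 (integral_nonneg fun _ => norm_nonneg _)),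
        ← integral_const_mul]
      refine norm_integral_le_of_norm_le (hF1.norm.const_mul D) (Eventually.of_forall fun ξ => ?_)
      rw [norm_mul, norm_mul, norm_exp_dotProd, one_mul]
      by_cases h0 : F ξ = 0
      · simp [h0]
      · exact mul_le_mul_of_nonneg_right (hR x ξ h0) (norm_nonneg _)
    · have hz := ha.supp x hx
      have : ∀ ξ, symbolTaylor a k c x ξ = 0 := fun ξ => by
        simp [symbolTaylor, foldr_pdTheta_eq_zero hz]
      simp [oscInt, hz, this]
  refine (eLpNorm_mono hpt).trans ?_
  rw [eLpNorm_indicator_const hK.measurableSet (by norm_num) (by norm_num)]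
  have hI : ‖D * ∫ ξ, ‖F ξ‖‖ₑ = ENNReal.ofReal D * eLpNorm F 1 volume := by
    rw [Real.enorm_of_nonneg (mul_nonneg hD0 (integral_nonneg fun _ => norm_nonneg _)),
      ENNReal.ofReal_mul hD0, ofReal_integral_norm_eq_lintegral_enorm hF1,
      eLpNorm_one_eq_lintegral_enorm]
  have h1 := eLpNorm_one_le_of_support hr0 hF1.1 hFs
  have h2 : ENNReal.ofReal ((2 * r) ^ N) ^ (1 / 2 : ℝ) ≤ ENNReal.ofReal (jap c ^ (N : ℝ)) := by
    rw [ENNReal.ofReal_rpow_of_nonneg (by positivity) (by norm_num)]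
    refine ENNReal.ofReal_le_ofReal ?_
    have h3 : (2 * r) ^ N ≤ jap c ^ N := pow_le_pow_left₀ (by positivity) (by linarith) N
    have h4 : 1 ≤ jap c ^ N := one_le_pow₀ hjc1
    rw [Real.rpow_natCast]
    refine (Real.rpow_le_rpow (by positivity) h3 (by norm_num)).trans ?_
    simpa using Real.rpow_le_rpow_of_exponent_le h4 (by norm_num : (1 / 2 : ℝ) ≤ 1)
  have hvol : volume K ^ (1 / (2 : ℝ≥0∞).toReal) =
      ENNReal.ofReal ((volume K).toReal ^ (1 / 2 : ℝ)) := by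
    rw [← ENNReal.ofReal_rpow_of_nonneg ENNReal.toReal_nonneg (by norm_num),
      ENNReal.ofReal_toReal hK.measure_lt_top.ne]
    norm_num
  rw [hI, hvol]
  calc ENNReal.ofReal D * eLpNorm F 1 volume * ENNReal.ofReal ((volume K).toReal ^ (1 / 2 : ℝ))
      ≤ ENNReal.ofReal D * (eLpNorm F 2 volume * ENNReal.ofReal (jap c ^ (N : ℝ))) *
        ENNReal.ofReal ((volume K).toReal ^ (1 / 2 : ℝ)) := by
        gcongr
        exact h1.trans (by gcongr)
    _ = ENNReal.ofReal (D * jap c ^ (N : ℝ) * (volume K).toReal ^ (1 / 2 : ℝ)) *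
        eLpNorm F 2 volume := by
        rw [ENNReal.ofReal_mul (p := D * jap c ^ (N : ℝ)) (by positivity), ENNReal.ofReal_mul (p := D) hD0]
        ring
    _ = _ := by
        congr 2
        have : jap c ^ (-(N : ℝ)) * jap c ^ (N : ℝ) = 1 := by
          rw [← Real.rpow_add hjc]; simp
        rw [hD, mul_assoc _ (jap c ^ (-(N : ℝ))), this]
        ring

/-- `L²` bound for the oscillatory integral of a function supported in a frequency block. -/
theorem SymbolBound.eLpNorm_oscInt_le {ρ δ B p : ℝ} {k : ℕ} {K : Set (Fin N → ℝ)}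
    (ha : SymbolBound ρ δ B k K a) (hK : IsCompact K) (hp0 : 0 ≤ p) (hpρ : p ≤ ρ) (hρ1 : ρ ≤ 1)
    (hk : N ≤ (ρ - p) * k) {c : Fin N → ℝ} {F : (Fin N → ℝ) → ℂ}
    (hF1 : Integrable F) (hF2 : MemLp F 2) (hFs : ∀ ξ, F ξ ≠ 0 → ‖ξ - c‖ ≤ jap c ^ p / 4) :
    eLpNorm (oscInt a F) 2 volume ≤
      ENNReal.ofReal (B * blockConst N k K) * eLpNorm F 2 volume := by
  have hB := ha.nonneg
  have hT := fun (j : ℕ) (hj : j < k) (L : Fin j → Fin N) =>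
    eLpNorm_oscInt_taylorTerm_le ha hpρ hF1 hF2 hFs hj L
  set t : (j : ℕ) → (Fin j → Fin N) → (Fin N → ℝ) → ℂ := fun j L x =>
    ((1 / j.factorial : ℝ) : ℂ) * (List.ofFn L).foldr pdTheta a x c *
      oscInt (fun _ _ => 1) (fun ξ => ((∏ i, (ξ - c) (L i) : ℝ) : ℂ) * F ξ) x with ht
  have hsplit : oscInt a F = (∑ j ∈ Finset.range k, ∑ L : Fin j → Fin N, t j L) +
      oscInt (fun x ξ => a x ξ - symbolTaylor a k c x ξ) F := by
    funext x
    have hterm : ∀ j ∈ Finset.range k, ∀ L : Fin j → Fin N,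
        Integrable fun ξ => ((1 / j.factorial : ℝ) : ℂ) * (List.ofFn L).foldr pdTheta a x c *
          (Complex.exp (2 * (Real.pi : ℂ) * Complex.I * (dotProd x ξ : ℂ)) * 1 *
            (((∏ i, (ξ - c) (L i) : ℝ) : ℂ) * F ξ)) := fun j hj L =>
      (integrable_oscInt_integrand (a := fun _ _ => 1) continuous_const (B := 1) (by simp)
        (hT j (Finset.mem_range.1 hj) L).1 x).const_mul _
    have hsum : ∀ ξ, ∑ j ∈ Finset.range k, ∑ L : Fin j → Fin N,
        ((1 / j.factorial : ℝ) : ℂ) * (List.ofFn L).foldr pdTheta a x c *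
          (Complex.exp (2 * (Real.pi : ℂ) * Complex.I * (dotProd x ξ : ℂ)) * 1 *
            (((∏ i, (ξ - c) (L i) : ℝ) : ℂ) * F ξ)) =
        Complex.exp (2 * (Real.pi : ℂ) * Complex.I * (dotProd x ξ : ℂ)) *
          symbolTaylor a k c x ξ * F ξ := by
      intro ξ
      simp only [symbolTaylor, Finset.mul_sum, Finset.sum_mul]
      refine Finset.sum_congr rfl fun j _ => Finset.sum_congr rfl fun L _ => ?_
      ring
    have hint := integrable_finsetSum (μ := volume) (Finset.range k) fun j hj =>
      integrable_finsetSum (μ := volume) Finset.univ fun L _ => hterm j hj L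
    simp_rw [hsum] at hint
    have hA := integrable_oscInt_integrand ha.continuous ha.norm_le hF1 x
    rw [Pi.add_apply, Finset.sum_apply]
    simp only [Finset.sum_apply, ht]
    have hswap : ∑ j ∈ Finset.range k, ∑ L : Fin j → Fin N,
        ((1 / j.factorial : ℝ) : ℂ) * (List.ofFn L).foldr pdTheta a x c *
          oscInt (fun _ _ => 1) (fun ξ => ((∏ i, (ξ - c) (L i) : ℝ) : ℂ) * F ξ) x =
        oscInt (symbolTaylor a k c) F x := by
      unfold oscInt
      simp_rw [← hsum]
      rw [integral_finsetSum _ fun j hj => integrable_finsetSum _ fun L _ => hterm j hj L]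
      refine Finset.sum_congr rfl fun j hj => ?_
      rw [integral_finsetSum _ fun L _ => hterm j hj L]
      refine Finset.sum_congr rfl fun L _ => ?_
      rw [integral_const_mul]
    rw [hswap]
    unfold oscInt
    rw [← integral_add hint (by
      refine (hA.sub hint).congr (Eventually.of_forall fun ξ => ?_)
      simp only [Pi.sub_apply]
      ring)]
    refine integral_congr_ae (Eventually.of_forall fun ξ => ?_)
    ring
  have hmt : ∀ j ∈ Finset.range k, ∀ L : Fin j → Fin N, AEStronglyMeasurable (t j L) volume := by
    intro j hj L
    refine AEStronglyMeasurable.mul (Continuous.aestronglyMeasurable ?_)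
      (aestronglyMeasurable_oscInt continuous_const (hT j (Finset.mem_range.1 hj) L).1.1)
    exact continuous_const.mul ((contDiff_foldr_pdTheta ha.smooth (List.ofFn L)).continuous.comp
      (continuous_id.prodMk continuous_const))
  have hms : AEStronglyMeasurable (∑ j ∈ Finset.range k, ∑ L : Fin j → Fin N, t j L) volume :=
    Finset.aestronglyMeasurable_sum _ fun j hj =>
      Finset.aestronglyMeasurable_sum _ fun L _ => hmt j hj L
  have hmr : AEStronglyMeasurable
      (oscInt (fun x ξ => a x ξ - symbolTaylor a k c x ξ) F) volume := by
    have h := aestronglyMeasurable_oscInt ha.continuous hF1.1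
    rw [hsplit] at h
    simpa using h.sub hms
  rw [hsplit]
  refine (eLpNorm_add_le hms hmr (by norm_num)).trans ?_
  rw [blockConst, mul_add, ENNReal.ofReal_add (by positivity) (by positivity), add_mul]
  refine add_le_add ?_
    (eLpNorm_oscInt_remainder_le ha hK hp0 hpρ hρ1 hk hF1 hFs)
  refine (eLpNorm_sum_le (fun j hj => Finset.aestronglyMeasurable_sum _ fun L _ => hmt j hj L)
    (by norm_num)).trans ?_
  rw [Finset.mul_sum, ENNReal.ofReal_sum_of_nonneg fun j _ => by positivity, Finset.sum_mul]
  refine Finset.sum_le_sum fun j hj => ?_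
  refine (eLpNorm_sum_le (fun L _ => hmt j hj L) (by norm_num)).trans ?_
  refine (Finset.sum_le_card_nsmul _ _ _ fun L _ =>
    (hT j (Finset.mem_range.1 hj) L).2).trans_eq ?_
  rw [Finset.card_univ, Fintype.card_fun, Fintype.card_fin, Fintype.card_fin, nsmul_eq_mul,
    ENNReal.ofReal_mul hB, ENNReal.ofReal_pow (by positivity), ENNReal.ofReal_natCast]
  push_cast
  ring

end Block

section Decay

variable {N : ℕ} {a : (Fin N → ℝ) → (Fin N → ℝ) → ℂ}

theorem foldr_pdX_eq_zero {K : Set (Fin N → ℝ)} (hK : IsClosed K)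
    (ha : ∀ x ∉ K, ∀ ξ, a x ξ = 0) (L : List (Fin N)) :
    ∀ x ∉ K, ∀ ξ, L.foldr pdX a x ξ = 0 := by
  induction L with
  | nil => exact ha
  | cons i L ih =>
    intro x hx ξ
    have h : (fun y => L.foldr pdX a y ξ) =ᶠ[nhds x] fun _ => 0 := by
      filter_upwards [hK.isOpen_compl.mem_nhds hx] with y hy using ih y hy ξ
    simp [List.foldr_cons, pdX, h.fderiv_eq]

theorem norm_fourierT_le_of_support {g : (Fin N → ℝ) → ℂ} {K : Set (Fin N → ℝ)} {M : ℝ}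
    (hK : IsCompact K) (hg : ∀ x ∉ K, g x = 0) (hM : ∀ x, ‖g x‖ ≤ M) (ζ : Fin N → ℝ) :
    ‖fourierT g ζ‖ ≤ M * (volume K).toReal := by
  unfold fourierT
  rw [← setIntegral_eq_integral_of_forall_compl_eq_zero (s := K) fun x hx => by simp [hg x hx]]
  refine norm_setIntegral_le_of_norm_le_const hK.measure_lt_top fun x _ => ?_
  rw [norm_mul, norm_exp_neg_dotProd, one_mul]
  exact hM x

theorem hasFDerivAt_exp_neg_dotProd (ζ x : Fin N → ℝ) :
    ∃ f' : (Fin N → ℝ) →L[ℝ] ℂ, HasFDerivAt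
      (fun y => Complex.exp (-(2 * (Real.pi : ℂ) * Complex.I * (dotProd y ζ : ℂ)))) f' x ∧
      ∀ i, f' (Pi.single i 1) = -(2 * (Real.pi : ℂ) * Complex.I * (ζ i : ℂ)) *
        Complex.exp (-(2 * (Real.pi : ℂ) * Complex.I * (dotProd x ζ : ℂ))) := by
  let l : (Fin N → ℝ) →L[ℝ] ℝ := ∑ i, ζ i • ContinuousLinearMap.proj (R := ℝ) i
  have hl : ∀ y, l y = dotProd y ζ := fun y => by
    simp [l, dotProd, mul_comm]
  have h1 : HasFDerivAt (fun y => (dotProd y ζ : ℂ)) (Complex.ofRealCLM.comp l) x := by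
    have := (Complex.ofRealCLM.comp l).hasFDerivAt (x := x)
    refine this.congr_of_eventuallyEq (Eventually.of_forall fun y => ?_)
    simp [hl]
  refine ⟨_, ((h1.const_mul (2 * (Real.pi : ℂ) * Complex.I)).neg).cexp, fun i => ?_⟩
  have hs : dotProd (Pi.single i 1) ζ = ζ i := by
    simp [dotProd, Pi.single_apply]
  simp [hl, hs]
  ring

theorem fourierT_fderiv {g : (Fin N → ℝ) → ℂ} (hg : ContDiff ℝ 1 g) (hgs : HasCompactSupport g)
    (i : Fin N) (ζ : Fin N → ℝ) :
    fourierT (fun x => fderiv ℝ g x (Pi.single i 1)) ζ =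
      2 * (Real.pi : ℂ) * Complex.I * (ζ i : ℂ) * fourierT g ζ := by
  have hc : Continuous fun y : Fin N → ℝ =>
      Complex.exp (-(2 * (Real.pi : ℂ) * Complex.I * (dotProd y ζ : ℂ))) := by
    unfold dotProd
    fun_prop
  have hd : ∀ x, fderiv ℝ (fun y =>
      Complex.exp (-(2 * (Real.pi : ℂ) * Complex.I * (dotProd y ζ : ℂ)))) x (Pi.single i 1) =
      -(2 * (Real.pi : ℂ) * Complex.I * (ζ i : ℂ)) *
        Complex.exp (-(2 * (Real.pi : ℂ) * Complex.I * (dotProd x ζ : ℂ))) := fun x => by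
    obtain ⟨f', hf, hf'⟩ := hasFDerivAt_exp_neg_dotProd ζ x
    rw [hf.fderiv, hf']
  have hg' : Continuous fun x => fderiv ℝ g x (Pi.single i 1) :=
    (hg.continuous_fderiv one_ne_zero).clm_apply continuous_const
  have hgs' : HasCompactSupport fun x => fderiv ℝ g x (Pi.single i 1) := by
    refine (hgs.fderiv (𝕜 := ℝ)).mono' fun x hx => ?_
    refine subset_tsupport _ fun h => hx ?_
    simp [h]
  have key := integral_mul_fderiv_eq_neg_fderiv_mul_of_integrable (μ := volume)
    (f := fun y => Complex.exp (-(2 * (Real.pi : ℂ) * Complex.I * (dotProd y ζ : ℂ))))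
    (g := g) (v := Pi.single i 1)
    (by
      simp_rw [hd]
      exact ((continuous_const.mul hc).mul hg.continuous).integrable_of_hasCompactSupport
        hgs.mul_left)
    ((hc.mul hg').integrable_of_hasCompactSupport hgs'.mul_left)
    ((hc.mul hg.continuous).integrable_of_hasCompactSupport hgs.mul_left)
    (fun x _ => (hasFDerivAt_exp_neg_dotProd ζ x).choose_spec.1.differentiableAt)
    (fun x _ => (hg.differentiable one_ne_zero).differentiableAt)
  unfold fourierT
  rw [key, ← integral_const_mul, ← integral_neg]
  refine integral_congr_ae (Eventually.of_forall fun x => ?_)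
  simp only [hd]
  ring

theorem fourierT_foldr_pdX {K : Set (Fin N → ℝ)} (hK : IsCompact K)
    (ha : ContDiff ℝ ∞ (Function.uncurry a)) (has : ∀ x ∉ K, ∀ ξ, a x ξ = 0)
    (i : Fin N) (M : ℕ) (ξ ζ : Fin N → ℝ) :
    fourierT (fun x => (List.replicate M i).foldr pdX a x ξ) ζ =
      (2 * (Real.pi : ℂ) * Complex.I * (ζ i : ℂ)) ^ M * fourierT (fun x => a x ξ) ζ := by
  induction M with
  | zero => simp
  | succ M ih =>
    have h1 : ContDiff ℝ 1 fun x => (List.replicate M i).foldr pdX a x ξ :=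
      ((contDiff_foldr_pdX ha (List.replicate M i)).comp
        (contDiff_id.prodMk contDiff_const)).of_le (by exact_mod_cast le_top)
    have h2 : HasCompactSupport fun x => (List.replicate M i).foldr pdX a x ξ :=
      HasCompactSupport.intro hK fun x hx => foldr_pdX_eq_zero hK.isClosed has _ x hx ξ
    rw [pow_succ', mul_assoc, ← ih, ← fourierT_fderiv h1 h2]
    rfl

theorem SymbolBound.pow_norm_mul_norm_fourierT_le {ρ δ B : ℝ} {k : ℕ} {K : Set (Fin N → ℝ)}
    (ha : SymbolBound ρ δ B k K a) (hN : 1 ≤ N) (hK : IsCompact K) {M : ℕ} (hM : M ≤ k)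
    (ξ ζ : Fin N → ℝ) :
    ‖ζ‖ ^ M * ‖fourierT (fun x => a x ξ) ζ‖ ≤ B * jap ξ ^ (δ * M) * (volume K).toReal := by
  have : Nonempty (Fin N) := ⟨⟨0, hN⟩⟩
  obtain ⟨i, hi⟩ := Finite.exists_max fun i => ‖ζ i‖
  have hζ : ‖ζ‖ ≤ ‖ζ i‖ := (pi_norm_le_iff_of_nonneg (norm_nonneg _)).2 hi
  have h1 := norm_fourierT_le_of_support hK
    (fun x hx => foldr_pdX_eq_zero hK.isClosed ha.supp (List.replicate M i) x hx ξ)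
    (fun x => ha.bound_x (List.replicate M i) (by simpa using hM) x ξ) ζ
  rw [fourierT_foldr_pdX hK ha.smooth ha.supp, norm_mul, norm_pow, List.length_replicate] at h1
  refine le_trans ?_ h1
  refine mul_le_mul_of_nonneg_right (pow_le_pow_left₀ (norm_nonneg _) ?_ M) (norm_nonneg _)
  refine hζ.trans ?_
  have hpi := Real.pi_gt_three
  rw [norm_mul, Complex.norm_real, norm_mul, Complex.norm_I, mul_one, norm_mul, Complex.norm_real,
    Real.norm_of_nonneg Real.pi_pos.le, Complex.norm_ofNat]
  exact le_mul_of_one_le_left (norm_nonneg _) (by linarith)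

/-- The constant in the off-diagonal decay bound. -/
noncomputable def decayConst (N M : ℕ) (K : Set (Fin N → ℝ)) : ℝ :=
  8 ^ M * 9 ^ (N + 1) * (volume K).toReal

theorem SymbolBound.norm_fourierT_le {ρ δ B p : ℝ} {k : ℕ} {K : Set (Fin N → ℝ)}
    (ha : SymbolBound ρ δ B k K a) (hN : 1 ≤ N) (hK : IsCompact K) (hp0 : 0 ≤ p) {M : ℕ}
    (hM : M + (N + 1) ≤ k) (hδ : δ * (M + (N + 1) : ℕ) ≤ p * M) {ξ ζ : Fin N → ℝ}
    (hζ : scale p ξ ≤ ‖ζ‖) :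
    ‖fourierT (fun x => a x ξ) ζ‖ ≤
      B * decayConst N M K * (1 + ‖ζ‖) ^ (-((N + 1 : ℕ) : ℝ)) := by
  have h := ha.pow_norm_mul_norm_fourierT_le hN hK hM ξ ζ
  have hB := ha.nonneg
  have hj := jap_pos ξ
  have hp1 : 1 ≤ jap ξ ^ p := Real.one_le_rpow (one_le_jap ξ) hp0
  unfold scale at hζ
  have hζ1 : 1 + ‖ζ‖ ≤ 9 * ‖ζ‖ := by linarith
  have hζ0 : 0 < ‖ζ‖ := by linarith
  set A := ‖fourierT (fun x => a x ξ) ζ‖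
  have hA : 0 ≤ A := norm_nonneg _
  have hw : jap ξ ^ (δ * (M + (N + 1) : ℕ)) ≤ (8 * ‖ζ‖) ^ M := by
    refine (Real.rpow_le_rpow_of_exponent_le (one_le_jap ξ) hδ).trans ?_
    rw [Real.rpow_mul hj.le, Real.rpow_natCast]
    exact pow_le_pow_left₀ (by positivity) (by linarith) M
  have h2 : ‖ζ‖ ^ M * (‖ζ‖ ^ (N + 1) * A) ≤ ‖ζ‖ ^ M * (B * 8 ^ M * (volume K).toReal) := by
    calc ‖ζ‖ ^ M * (‖ζ‖ ^ (N + 1) * A) = ‖ζ‖ ^ (M + (N + 1)) * A := by ring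
      _ ≤ _ := h
      _ ≤ B * (8 * ‖ζ‖) ^ M * (volume K).toReal := by gcongr
      _ = _ := by ring
  have h3 := le_of_mul_le_mul_left h2 (by positivity)
  rw [Real.rpow_neg (by positivity), Real.rpow_natCast, ← div_eq_mul_inv,
    le_div_iff₀ (by positivity)]
  calc A * (1 + ‖ζ‖) ^ (N + 1) ≤ A * (9 * ‖ζ‖) ^ (N + 1) := by gcongr
    _ = 9 ^ (N + 1) * (‖ζ‖ ^ (N + 1) * A) := by ring
    _ ≤ 9 ^ (N + 1) * (B * 8 ^ M * (volume K).toReal) := by gcongr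
    _ = _ := by unfold decayConst; ring

end Decay

section CauchySchwarz

variable {α : Type*} [MeasurableSpace α] {μ : Measure α}

theorem lintegral_sq_le_mul_of_sq_le {f g h : α → ℝ≥0∞} (hf : Measurable f) (hg : Measurable g)
    (hh : ∀ x, h x ^ 2 ≤ f x * g x) :
    (∫⁻ x, h x ∂μ) ^ 2 ≤ (∫⁻ x, f x ∂μ) * ∫⁻ x, g x ∂μ := by
  have hsq : ∀ y : ℝ≥0∞, (y ^ (1 / 2 : ℝ)) ^ (2 : ℝ) = y := fun y => by
    rw [← ENNReal.rpow_mul]; norm_num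
  have hle : ∀ x, h x ≤ f x ^ (1 / 2 : ℝ) * g x ^ (1 / 2 : ℝ) := fun x => by
    rw [← ENNReal.mul_rpow_of_nonneg _ _ (by norm_num)]
    refine le_trans (le_of_eq ?_) (ENNReal.rpow_le_rpow (hh x) (by norm_num))
    rw [← ENNReal.rpow_natCast, ← ENNReal.rpow_mul]
    norm_num
  have key := ENNReal.lintegral_mul_le_Lp_mul_Lq μ Real.HolderConjugate.two_two
    (f := fun x => f x ^ (1 / 2 : ℝ)) (g := fun x => g x ^ (1 / 2 : ℝ))
    (hf.pow_const _).aemeasurable (hg.pow_const _).aemeasurable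
  simp only [hsq] at key
  have := (lintegral_mono hle).trans key
  refine (pow_le_pow_left' this 2).trans_eq ?_
  rw [mul_pow, ← ENNReal.rpow_natCast, ← ENNReal.rpow_natCast, Nat.cast_ofNat, hsq, hsq]

theorem eLpNorm_two_sq (u : α → ℂ) : eLpNorm u 2 μ ^ 2 = ∫⁻ x, ‖u x‖ₑ ^ 2 ∂μ := by
  have := eLpNorm_nnreal_pow_eq_lintegral (f := u) (μ := μ) (p := 2) two_ne_zero
  simpa using this

end CauchySchwarz

section Assembly

variable {N : ℕ} {a : (Fin N → ℝ) → (Fin N → ℝ) → ℂ} {ρ δ B p : ℝ} {k : ℕ}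
  {K : Set (Fin N → ℝ)}

theorem measurable_fourierT_symbol (ha : Continuous (Function.uncurry a)) :
    Measurable fun q : (Fin N → ℝ) × (Fin N → ℝ) => fourierT (fun x => a x q.2) q.1 := by
  have : StronglyMeasurable fun r : ((Fin N → ℝ) × (Fin N → ℝ)) × (Fin N → ℝ) =>
      Complex.exp (-(2 * (Real.pi : ℂ) * Complex.I * (dotProd r.2 r.1.1 : ℂ))) * a r.2 r.1.2 := by
    have h1 : Continuous fun r : ((Fin N → ℝ) × (Fin N → ℝ)) × (Fin N → ℝ) => a r.2 r.1.2 :=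
      ha.comp (by fun_prop : Continuous fun r : ((Fin N → ℝ) × (Fin N → ℝ)) × (Fin N → ℝ) =>
        (r.2, r.1.2))
    have h2 : Continuous fun r : ((Fin N → ℝ) × (Fin N → ℝ)) × (Fin N → ℝ) =>
        dotProd r.2 r.1.1 :=
      continuous_dotProd.comp (by fun_prop :
        Continuous fun r : ((Fin N → ℝ) × (Fin N → ℝ)) × (Fin N → ℝ) => (r.2, r.1.1))
    exact Continuous.stronglyMeasurable (by fun_prop)
  exact this.integral_prod_right'.measurable

theorem measurable_fourierT {f : (Fin N → ℝ) → ℂ} (hf : Continuous f) :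
    Measurable (fourierT f) := by
  have h : StronglyMeasurable fun r : (Fin N → ℝ) × (Fin N → ℝ) =>
      Complex.exp (-(2 * (Real.pi : ℂ) * Complex.I * (dotProd r.2 r.1 : ℂ))) * f r.2 := by
    have h1 : Continuous fun r : (Fin N → ℝ) × (Fin N → ℝ) => dotProd r.2 r.1 :=
      continuous_dotProd.comp continuous_swap
    exact Continuous.stronglyMeasurable (by fun_prop)
  exact h.integral_prod_right'.measurable

/-- The Fourier transform of an oscillatory integral. -/
theorem SymbolBound.fourierT_oscInt (ha : SymbolBound ρ δ B k K a) (hK : IsCompact K)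
    {F : (Fin N → ℝ) → ℂ} (hF : Integrable F) (η : Fin N → ℝ) :
    (Integrable fun ξ => fourierT (fun x => a x ξ) (η - ξ) * F ξ) ∧
      fourierT (oscInt a F) η = ∫ ξ, fourierT (fun x => a x ξ) (η - ξ) * F ξ := by
  have hc : Continuous fun q : (Fin N → ℝ) × (Fin N → ℝ) =>
      Complex.exp (-(2 * (Real.pi : ℂ) * Complex.I * (dotProd q.1 (η - q.2) : ℂ))) * a q.1 q.2 := by
    have h1 : Continuous fun q : (Fin N → ℝ) × (Fin N → ℝ) => a q.1 q.2 := ha.continuous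
    have h2 : Continuous fun q : (Fin N → ℝ) × (Fin N → ℝ) => dotProd q.1 (η - q.2) :=
      continuous_dotProd.comp (by fun_prop :
        Continuous fun q : (Fin N → ℝ) × (Fin N → ℝ) => (q.1, η - q.2))
    fun_prop
  have hint : Integrable (fun q : (Fin N → ℝ) × (Fin N → ℝ) =>
      Complex.exp (-(2 * (Real.pi : ℂ) * Complex.I * (dotProd q.1 (η - q.2) : ℂ))) * a q.1 q.2 *
        F q.2) (volume.prod volume) := by
    have hdom : Integrable (fun q : (Fin N → ℝ) × (Fin N → ℝ) =>
        K.indicator (fun _ => B) q.1 * ‖F q.2‖) (volume.prod volume) :=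
      (((integrableOn_const hK.measure_lt_top.ne).integrable_indicator
        hK.measurableSet)).mul_prod hF.norm
    refine hdom.mono' (hc.aestronglyMeasurable.mul hF.1.comp_snd) (Eventually.of_forall fun q => ?_)
    rw [norm_mul, norm_mul, norm_exp_neg_dotProd, one_mul]
    refine mul_le_mul_of_nonneg_right ?_ (norm_nonneg _)
    by_cases hq : q.1 ∈ K
    · rw [Set.indicator_of_mem hq]
      exact ha.norm_le _ _
    · simp [ha.supp _ hq, hq]
  have hmul : ∀ ξ, ∫ x, Complex.exp (-(2 * (Real.pi : ℂ) * Complex.I * (dotProd x (η - ξ) : ℂ))) *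
      a x ξ * F ξ = fourierT (fun x => a x ξ) (η - ξ) * F ξ := fun ξ => by
    rw [integral_mul_const]
    rfl
  constructor
  · have := hint.integral_prod_right
    simpa only [hmul] using this
  · simp_rw [← hmul]
    rw [← integral_integral_swap hint]
    unfold fourierT oscInt
    refine integral_congr_ae (Eventually.of_forall fun x => ?_)
    simp only
    rw [← integral_const_mul]
    refine integral_congr_ae (Eventually.of_forall fun ξ => ?_)
    simp only
    rw [← mul_assoc, ← mul_assoc, ← Complex.exp_add, dotProd_sub]
    congr 3
    push_cast
    ring

/-- The part of `F` localized near the frequency `c`. -/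
noncomputable def localized (p : ℝ) (F : (Fin N → ℝ) → ℂ) (c ξ : Fin N → ℝ) : ℂ :=
  (window p c ξ : ℂ) * F ξ

theorem window_le (hp0 : 0 ≤ p) (c ξ : Fin N → ℝ) : window p c ξ ≤ 4 ^ N := by
  refine Set.indicator_apply_le' (fun _ => ?_) fun _ => by positivity
  have h : 1 ≤ jap ξ ^ p := Real.one_le_rpow (one_le_jap ξ) hp0
  rw [← inv_pow]
  refine pow_le_pow_left₀ (by have := scale_pos p ξ; positivity) ?_ N
  unfold scale
  rw [inv_le_comm₀ (by positivity) (by norm_num)]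
  linarith

theorem integrable_localized (hp0 : 0 ≤ p) {F : (Fin N → ℝ) → ℂ} (hF : Integrable F)
    (c : Fin N → ℝ) : Integrable (localized p F c) := by
  refine hF.bdd_mul (c := 4 ^ N)
    (Complex.measurable_ofReal.comp (measurable_window_right p c)).aestronglyMeasurable
    (Eventually.of_forall fun ξ => ?_)
  rw [Complex.norm_real, Real.norm_of_nonneg (window_nonneg p c ξ)]
  exact window_le hp0 c ξ

theorem memLp_localized (hp0 : 0 ≤ p) {F : (Fin N → ℝ) → ℂ} (hF : MemLp F 2)
    (c : Fin N → ℝ) : MemLp (localized p F c) 2 := by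
  refine hF.of_le_mul (c := 4 ^ N)
    ((Complex.measurable_ofReal.comp (measurable_window_right p c)).aestronglyMeasurable.mul hF.1)
    (Eventually.of_forall fun ξ => ?_)
  rw [localized, norm_mul, Complex.norm_real, Real.norm_of_nonneg (window_nonneg p c ξ)]
  exact mul_le_mul_of_nonneg_right (window_le hp0 c ξ) (norm_nonneg _)

theorem norm_sub_le_of_localized_ne_zero (hp0 : 0 ≤ p) (hp1 : p ≤ 1) {F : (Fin N → ℝ) → ℂ}
    {c ξ : Fin N → ℝ} (h : localized p F c ξ ≠ 0) : ‖ξ - c‖ ≤ jap c ^ p / 4 := by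
  have hw : window p c ξ ≠ 0 := fun h0 => h (by simp [localized, h0])
  have h1 := norm_sub_le_of_window_ne_zero hw
  have h2 := scale_le_add hp0 hp1 ξ c
  have h3 := scale_pos p c
  have h4 : scale p c = jap c ^ p / 8 := rfl
  linarith

theorem scale_le_of_notMem_nearSet (hp0 : 0 ≤ p) (hp1 : p ≤ 1) {c η ξ : Fin N → ℝ}
    (hn : (c, η) ∉ nearSet p) (hw : window p c ξ ≠ 0) : scale p ξ ≤ ‖η - ξ‖ := by
  have h1 := norm_sub_le_of_window_ne_zero hw
  have h2 := scale_le_add hp0 hp1 ξ c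
  have h3 := scale_pos p ξ
  have h4 : 4 * scale p c < ‖η - c‖ := not_le.1 hn
  have h5 : ‖η - c‖ ≤ ‖η - ξ‖ + ‖ξ - c‖ := by
    simpa using norm_add_le (η - ξ) (ξ - c)
  linarith

theorem SymbolBound.integrable_oscInt (ha : SymbolBound ρ δ B k K a) (hK : IsCompact K)
    {F : (Fin N → ℝ) → ℂ} (hF : Integrable F) :
    Integrable (oscInt a F) ∧ MemLp (oscInt a F) 2 := by
  have hm := aestronglyMeasurable_oscInt ha.continuous hF.1
  have hle : ∀ x, ‖oscInt a F x‖ ≤ ‖K.indicator (fun _ => B * ∫ ξ, ‖F ξ‖) x‖ := by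
    intro x
    by_cases hx : x ∈ K
    · rw [Set.indicator_of_mem hx, Real.norm_of_nonneg
        (mul_nonneg ha.nonneg (integral_nonneg fun _ => norm_nonneg _)), ← integral_const_mul]
      refine norm_integral_le_of_norm_le (hF.norm.const_mul B) (Eventually.of_forall fun ξ => ?_)
      rw [norm_mul, norm_mul, norm_exp_dotProd, one_mul]
      exact mul_le_mul_of_nonneg_right (ha.norm_le x ξ) (norm_nonneg _)
    · simp [oscInt, ha.supp x hx]
  have hind : ∀ q : ℝ≥0∞, MemLp (K.indicator fun _ => B * ∫ ξ, ‖F ξ‖) q volume := fun q =>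
    memLp_indicator_const q hK.measurableSet _ (Or.inr hK.measure_lt_top.ne)
  exact ⟨memLp_one_iff_integrable.1 ((hind 1).mono hm (Eventually.of_forall hle)),
    (hind 2).mono hm (Eventually.of_forall hle)⟩

end Assembly

section L2Bound

variable {N : ℕ} {a : (Fin N → ℝ) → (Fin N → ℝ) → ℂ} {ρ δ B p : ℝ} {k : ℕ}
  {K : Set (Fin N → ℝ)}

theorem measurable_window_left (p : ℝ) (ξ : Fin N → ℝ) : Measurable fun c => window p c ξ :=
  (measurable_window p).of_uncurry_right

theorem lintegral_window (p : ℝ) (ξ : Fin N → ℝ) :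
    ∫⁻ c, ENNReal.ofReal (window p c ξ) = 1 := by
  rw [← ofReal_integral_eq_lintegral_ofReal (integrable_window p ξ)
    (Eventually.of_forall fun c => window_nonneg p c ξ), integral_window, ENNReal.ofReal_one]

theorem enorm_integral_le_lintegral_window {G : (Fin N → ℝ) → ℂ} (hG : Integrable G) (p : ℝ) :
    ‖∫ ξ, G ξ‖ₑ ≤ ∫⁻ c, ‖∫ ξ, (window p c ξ : ℂ) * G ξ‖ₑ := by
  have hmeas : AEStronglyMeasurable (fun q : (Fin N → ℝ) × (Fin N → ℝ) =>
      (window p q.1 q.2 : ℂ) * G q.2) (volume.prod volume) :=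
    (Complex.measurable_ofReal.comp (measurable_window p)).aestronglyMeasurable.mul hG.1.comp_snd
  have hint : Integrable (fun q : (Fin N → ℝ) × (Fin N → ℝ) =>
      (window p q.1 q.2 : ℂ) * G q.2) (volume.prod volume) := by
    refine (integrable_prod_iff' hmeas).2 ⟨Eventually.of_forall fun ξ => ?_, ?_⟩
    · exact ((integrable_window p ξ).ofReal (𝕜 := ℂ)).mul_const (G ξ)
    · refine hG.norm.congr (Eventually.of_forall fun ξ => ?_)
      simp only [norm_mul, Complex.norm_real, Real.norm_of_nonneg (window_nonneg p _ ξ)]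
      rw [integral_mul_const, integral_window, one_mul]
  have h : ∫ ξ, G ξ = ∫ c, ∫ ξ, (window p c ξ : ℂ) * G ξ := by
    rw [integral_integral_swap hint]
    refine integral_congr_ae (Eventually.of_forall fun ξ => ?_)
    simp only
    rw [integral_mul_const, integral_complex_ofReal, integral_window, Complex.ofReal_one, one_mul]
  rw [h]
  exact enorm_integral_le_lintegral_enorm _

/-- The decaying convolution kernel dominating the off-diagonal part. -/
noncomputable def decayKernel (ζ : Fin N → ℝ) : ℝ≥0∞ :=
  ENNReal.ofReal ((1 + ‖ζ‖) ^ (-((N + 1 : ℕ) : ℝ)))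

theorem measurable_decayKernel : Measurable (decayKernel (N := N)) := by
  unfold decayKernel
  fun_prop

theorem lintegral_decayKernel_lt_top : ∫⁻ ζ : Fin N → ℝ, decayKernel ζ < ⊤ := by
  have h : Integrable fun ζ : Fin N → ℝ => (1 + ‖ζ‖) ^ (-((N + 1 : ℕ) : ℝ)) :=
    integrable_one_add_norm (by simp)
  exact h.lintegral_lt_top

theorem SymbolBound.enorm_fourierT_oscInt_le (ha : SymbolBound ρ δ B k K a) (hN : 1 ≤ N)
    (hK : IsCompact K) (hp0 : 0 ≤ p) (hp1 : p ≤ 1) {M : ℕ} (hM : M + (N + 1) ≤ k)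
    (hδ : δ * (M + (N + 1) : ℕ) ≤ p * M) {F : (Fin N → ℝ) → ℂ} (hF : Integrable F)
    (hFm : Measurable F) (η : Fin N → ℝ) :
    ‖fourierT (oscInt a F) η‖ₑ ≤
      (∫⁻ c, (nearSet p).indicator (fun q => ‖fourierT (oscInt a (localized p F q.1)) q.2‖ₑ)
        (c, η)) +
      ENNReal.ofReal (B * decayConst N M K) * ∫⁻ ξ, decayKernel (η - ξ) * ‖F ξ‖ₑ := by
  obtain ⟨hG, hGe⟩ := ha.fourierT_oscInt hK hF η
  set G := fun ξ => fourierT (fun x => a x ξ) (η - ξ) * F ξ with hGdef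
  have hloc : ∀ c, fourierT (oscInt a (localized p F c)) η = ∫ ξ, (window p c ξ : ℂ) * G ξ := by
    intro c
    rw [(ha.fourierT_oscInt hK (integrable_localized hp0 hF c) η).2]
    refine integral_congr_ae (Eventually.of_forall fun ξ => ?_)
    simp only [localized, hGdef]
    ring
  have hBd : 0 ≤ B * decayConst N M K := by
    have := ha.nonneg
    unfold decayConst
    positivity
  have hsplit : ∀ c, ‖∫ ξ, (window p c ξ : ℂ) * G ξ‖ₑ ≤
      (nearSet p).indicator (fun q => ‖fourierT (oscInt a (localized p F q.1)) q.2‖ₑ) (c, η) +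
      ∫⁻ ξ, ENNReal.ofReal (window p c ξ) *
        (ENNReal.ofReal (B * decayConst N M K) * (decayKernel (η - ξ) * ‖F ξ‖ₑ)) := by
    intro c
    by_cases hc : (c, η) ∈ nearSet p
    · rw [Set.indicator_of_mem hc, hloc]
      exact le_self_add
    · refine le_add_left ((enorm_integral_le_lintegral_enorm _).trans
        (lintegral_mono fun ξ => ?_))
      rw [enorm_mul, hGdef, enorm_mul]
      have hw : ‖(window p c ξ : ℂ)‖ₑ = ENNReal.ofReal (window p c ξ) := by
        rw [← ofReal_norm, Complex.norm_real, Real.norm_of_nonneg (window_nonneg p c ξ)]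
      rw [hw]
      by_cases h0 : window p c ξ = 0
      · simp [h0]
      · have := ha.norm_fourierT_le hN hK hp0 hM hδ (scale_le_of_notMem_nearSet hp0 hp1 hc h0)
        rw [← mul_assoc (ENNReal.ofReal (B * decayConst N M K))]
        gcongr
        rw [decayKernel, ← ENNReal.ofReal_mul hBd, ← ofReal_norm]
        exact ENNReal.ofReal_le_ofReal this
  have hwm : Measurable fun q : (Fin N → ℝ) × (Fin N → ℝ) =>
      ENNReal.ofReal (window p q.1 q.2) * (ENNReal.ofReal (B * decayConst N M K) *
        (decayKernel (η - q.2) * ‖F q.2‖ₑ)) := by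
    have h1 : Measurable fun q : (Fin N → ℝ) × (Fin N → ℝ) => decayKernel (η - q.2) :=
      measurable_decayKernel.comp (by fun_prop)
    have h2 : Measurable fun q : (Fin N → ℝ) × (Fin N → ℝ) => ‖F q.2‖ₑ :=
      (hFm.comp measurable_snd).enorm
    exact (measurable_window p).ennreal_ofReal.mul ((h1.mul h2).const_mul _)
  rw [hGe]
  refine (enorm_integral_le_lintegral_window hG p).trans ((lintegral_mono hsplit).trans ?_)
  rw [lintegral_add_right _ hwm.lintegral_prod_right']
  gcongr
  rw [lintegral_lintegral_swap hwm.aemeasurable]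
  have hm2 : Measurable fun ξ => decayKernel (η - ξ) * ‖F ξ‖ₑ :=
    (measurable_decayKernel.comp (by fun_prop)).mul hFm.enorm
  rw [← lintegral_const_mul _ hm2]
  refine lintegral_mono fun ξ => ?_
  have hwξ : Measurable fun c => ENNReal.ofReal (window p c ξ) :=
    (measurable_window_left p ξ).ennreal_ofReal
  simp only
  rw [lintegral_mul_const _ hwξ, lintegral_window, one_mul]

theorem lintegral_conv_sq_le {κ F : (Fin N → ℝ) → ℝ≥0∞} (hκ : Measurable κ) (hF : Measurable F) :
    ∫⁻ η, (∫⁻ ξ, κ (η - ξ) * F ξ) ^ 2 ≤ (∫⁻ ζ, κ ζ) ^ 2 * ∫⁻ ξ, F ξ ^ 2 := by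
  have hm : Measurable fun q : (Fin N → ℝ) × (Fin N → ℝ) => κ (q.1 - q.2) * F q.2 ^ 2 :=
    (hκ.comp (by fun_prop)).mul ((hF.comp measurable_snd).pow_const 2)
  calc ∫⁻ η, (∫⁻ ξ, κ (η - ξ) * F ξ) ^ 2
      ≤ ∫⁻ η, (∫⁻ ζ, κ ζ) * ∫⁻ ξ, κ (η - ξ) * F ξ ^ 2 := by
        refine lintegral_mono fun η => ?_
        have h := lintegral_sq_le_mul_of_sq_le (μ := volume) (f := fun ξ => κ (η - ξ))
          (g := fun ξ => κ (η - ξ) * F ξ ^ 2) (h := fun ξ => κ (η - ξ) * F ξ)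
          (hκ.comp (by fun_prop)) ((hκ.comp (by fun_prop)).mul (hF.pow_const 2))
          (fun ξ => le_of_eq (by ring))
        rwa [lintegral_sub_left_eq_self κ η] at h
    _ = (∫⁻ ζ, κ ζ) * ∫⁻ η, ∫⁻ ξ, κ (η - ξ) * F ξ ^ 2 :=
        lintegral_const_mul _ hm.lintegral_prod_right'
    _ = (∫⁻ ζ, κ ζ) * ∫⁻ ξ, ∫⁻ η, κ (η - ξ) * F ξ ^ 2 := by
        rw [lintegral_lintegral_swap hm.aemeasurable]
    _ = (∫⁻ ζ, κ ζ) * ∫⁻ ξ, (∫⁻ ζ, κ ζ) * F ξ ^ 2 := by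
        congr 1
        refine lintegral_congr fun ξ => ?_
        have hκξ : Measurable fun η => κ (η - ξ) := hκ.comp (by fun_prop)
        rw [lintegral_mul_const _ hκξ, lintegral_sub_right_eq_self κ ξ]
    _ = _ := by
        rw [lintegral_const_mul _ (hF.pow_const 2), sq, mul_assoc]

theorem SymbolBound.measurable_fourierT_localized (ha : SymbolBound ρ δ B k K a)
    (hK : IsCompact K) (hp0 : 0 ≤ p) {F : (Fin N → ℝ) → ℂ} (hF : Integrable F)
    (hFm : Measurable F) :
    Measurable fun q : (Fin N → ℝ) × (Fin N → ℝ) =>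
      fourierT (oscInt a (localized p F q.1)) q.2 := by
  have h : StronglyMeasurable fun r : ((Fin N → ℝ) × (Fin N → ℝ)) × (Fin N → ℝ) =>
      fourierT (fun x => a x r.2) (r.1.2 - r.2) * ((window p r.1.1 r.2 : ℂ) * F r.2) := by
    have h1 := (measurable_fourierT_symbol ha.continuous).comp (by fun_prop :
      Measurable fun r : ((Fin N → ℝ) × (Fin N → ℝ)) × (Fin N → ℝ) => (r.1.2 - r.2, r.2))
    have h2 := (measurable_window p).comp (by fun_prop :
      Measurable fun r : ((Fin N → ℝ) × (Fin N → ℝ)) × (Fin N → ℝ) => (r.1.1, r.2))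
    exact (h1.mul ((Complex.measurable_ofReal.comp h2).mul
      (hFm.comp measurable_snd))).stronglyMeasurable
  have hq : (fun q : (Fin N → ℝ) × (Fin N → ℝ) =>
      fourierT (oscInt a (localized p F q.1)) q.2) = fun q => ∫ ξ,
        fourierT (fun x => a x ξ) (q.2 - ξ) * ((window p q.1 ξ : ℂ) * F ξ) :=
    funext fun q => (ha.fourierT_oscInt hK (integrable_localized hp0 hF q.1) q.2).2
  rw [hq]
  exact (h.integral_prod_right' (ν := volume)).measurable

theorem measurable_ofReal_scale_pow (p : ℝ) :
    Measurable fun c : Fin N → ℝ => ENNReal.ofReal (scale p c ^ N) :=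
  ((continuous_scale p).measurable.pow_const N).ennreal_ofReal

theorem lintegral_indicator_nearSet_sq_le (hp0 : 0 ≤ p) (hp1 : p ≤ 1)
    {Φ : (Fin N → ℝ) × (Fin N → ℝ) → ℝ≥0∞} (hΦ : Measurable Φ) :
    ∫⁻ η, (∫⁻ c, (nearSet p).indicator Φ (c, η)) ^ 2 ≤
      ENNReal.ofReal (24 ^ N) * ∫⁻ c, ENNReal.ofReal (scale p c ^ N) * ∫⁻ η, Φ (c, η) ^ 2 := by
  have hsi : Measurable fun q : (Fin N → ℝ) × (Fin N → ℝ) =>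
      ENNReal.ofReal ((scale p q.1 ^ N)⁻¹) :=
    (((continuous_scale p).measurable.comp measurable_fst).pow_const N).inv.ennreal_ofReal
  have hm : Measurable fun q : (Fin N → ℝ) × (Fin N → ℝ) =>
      ENNReal.ofReal (scale p q.1 ^ N) * Φ q ^ 2 :=
    ((measurable_ofReal_scale_pow p).comp measurable_fst).mul (hΦ.pow_const 2)
  have hpair : ∀ η : Fin N → ℝ, Measurable fun c : Fin N → ℝ => (c, η) := fun η => by fun_prop
  calc _ ≤ ∫⁻ η, ENNReal.ofReal (24 ^ N) *
        ∫⁻ c, ENNReal.ofReal (scale p c ^ N) * Φ (c, η) ^ 2 := by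
        refine lintegral_mono fun η => ?_
        have hf : Measurable fun c => (nearSet p).indicator
            (fun q => ENNReal.ofReal ((scale p q.1 ^ N)⁻¹)) (c, η) :=
          (hsi.indicator (measurableSet_nearSet p)).comp (hpair η)
        have hg : Measurable fun c => ENNReal.ofReal (scale p c ^ N) * Φ (c, η) ^ 2 :=
          (measurable_ofReal_scale_pow p).mul ((hΦ.comp (hpair η)).pow_const 2)
        refine (lintegral_sq_le_mul_of_sq_le (μ := volume) hf hg fun c => ?_).trans ?_
        · by_cases hc : (c, η) ∈ nearSet p
          · have hsc := scale_pos p c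
            rw [Set.indicator_of_mem hc, Set.indicator_of_mem hc, ← mul_assoc,
              ← ENNReal.ofReal_mul (by positivity), inv_mul_cancel₀ (by positivity),
              ENNReal.ofReal_one, one_mul]
          · simp [Set.indicator_of_notMem hc]
        · gcongr
          exact lintegral_near_le hp0 hp1 η
    _ = ENNReal.ofReal (24 ^ N) *
        ∫⁻ c, ∫⁻ η, ENNReal.ofReal (scale p c ^ N) * Φ (c, η) ^ 2 := by
        rw [lintegral_const_mul _ hm.lintegral_prod_left',
          lintegral_lintegral_swap (f := fun c η =>
            ENNReal.ofReal (scale p c ^ N) * Φ (c, η) ^ 2) hm.aemeasurable]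
    _ = _ := by
        congr 1
        refine lintegral_congr fun c => lintegral_const_mul _ ?_
        exact (hΦ.comp (by fun_prop : Measurable fun η : Fin N → ℝ => (c, η))).pow_const 2

theorem lintegral_scale_mul_localized_le (hp0 : 0 ≤ p) (hp1 : p ≤ 1) {F : (Fin N → ℝ) → ℂ}
    (hFm : Measurable F) :
    ∫⁻ c, ENNReal.ofReal (scale p c ^ N) * ∫⁻ ξ, ‖localized p F c ξ‖ₑ ^ 2 ≤
      ∫⁻ ξ, ‖F ξ‖ₑ ^ 2 := by
  have hloc : ∀ c ξ, ‖localized p F c ξ‖ₑ ^ 2 =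
      ENNReal.ofReal (window p c ξ) ^ 2 * ‖F ξ‖ₑ ^ 2 := fun c ξ => by
    rw [localized, enorm_mul, mul_pow, ← ofReal_norm (window p c ξ : ℂ),
      Complex.norm_real, Real.norm_of_nonneg (window_nonneg p c ξ)]
  have hm : Measurable fun q : (Fin N → ℝ) × (Fin N → ℝ) =>
      ENNReal.ofReal (scale p q.1 ^ N) * (ENNReal.ofReal (window p q.1 q.2) ^ 2 * ‖F q.2‖ₑ ^ 2) :=
    ((measurable_ofReal_scale_pow p).comp measurable_fst).mul
      (((measurable_window p).ennreal_ofReal.pow_const 2).mul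
      ((hFm.comp measurable_snd).enorm.pow_const 2))
  calc _ = ∫⁻ c, ∫⁻ ξ, ENNReal.ofReal (scale p c ^ N) *
        (ENNReal.ofReal (window p c ξ) ^ 2 * ‖F ξ‖ₑ ^ 2) := by
        refine lintegral_congr fun c => ?_
        simp_rw [hloc]
        exact (lintegral_const_mul _ (((measurable_window_right p c).ennreal_ofReal.pow_const 2).mul
          (hFm.enorm.pow_const 2))).symm
    _ = ∫⁻ ξ, ∫⁻ c, ENNReal.ofReal (scale p c ^ N) *
        (ENNReal.ofReal (window p c ξ) ^ 2 * ‖F ξ‖ₑ ^ 2) :=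
        lintegral_lintegral_swap hm.aemeasurable
    _ ≤ _ := by
        refine lintegral_mono fun ξ => ?_
        simp_rw [← mul_assoc]
        have hw : Measurable fun c => ENNReal.ofReal (scale p c ^ N) *
            ENNReal.ofReal (window p c ξ) ^ 2 :=
          (measurable_ofReal_scale_pow p).mul
            ((measurable_window_left p ξ).ennreal_ofReal.pow_const 2)
        rw [lintegral_mul_const _ hw]
        exact mul_le_of_le_one_left' (lintegral_scale_mul_window_sq_le hp0 hp1 ξ)

theorem SymbolBound.lintegral_near_sq_le (ha : SymbolBound ρ δ B k K a) (hK : IsCompact K)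
    (hp0 : 0 ≤ p) (hpρ : p ≤ ρ) (hρ1 : ρ ≤ 1) (hk : N ≤ (ρ - p) * k) {F : (Fin N → ℝ) → ℂ}
    (hF : Integrable F) (hF2 : MemLp F 2) (hFm : Measurable F) :
    ∫⁻ η, (∫⁻ c, (nearSet p).indicator
        (fun q => ‖fourierT (oscInt a (localized p F q.1)) q.2‖ₑ) (c, η)) ^ 2 ≤
      ENNReal.ofReal (24 ^ N) * (ENNReal.ofReal (B * blockConst N k K) ^ 2 *
        ∫⁻ ξ, ‖F ξ‖ₑ ^ 2) := by
  have hp1 := hpρ.trans hρ1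
  have hblock : ∀ c, ∫⁻ η, ‖fourierT (oscInt a (localized p F c)) η‖ₑ ^ 2 ≤
      ENNReal.ofReal (B * blockConst N k K) ^ 2 * ∫⁻ ξ, ‖localized p F c ξ‖ₑ ^ 2 := by
    intro c
    have hLi := integrable_localized hp0 hF c
    obtain ⟨hu1, hu2⟩ := ha.integrable_oscInt hK hLi
    have hb := ha.eLpNorm_oscInt_le hK hp0 hpρ hρ1 hk hLi (memLp_localized hp0 hF2 c)
      fun ξ => norm_sub_le_of_localized_ne_zero hp0 hp1
    rw [← eLpNorm_fourierT hu1 hu2] at hb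
    have hb2 := pow_le_pow_left' hb 2
    rwa [mul_pow, eLpNorm_two_sq, eLpNorm_two_sq] at hb2
  have h1 := lintegral_indicator_nearSet_sq_le hp0 hp1
    (ha.measurable_fourierT_localized hK hp0 hF hFm).enorm
  refine h1.trans ?_
  gcongr
  calc _ ≤ ∫⁻ c, ENNReal.ofReal (B * blockConst N k K) ^ 2 *
        (ENNReal.ofReal (scale p c ^ N) * ∫⁻ ξ, ‖localized p F c ξ‖ₑ ^ 2) := by
        refine lintegral_mono fun c => ?_
        rw [mul_left_comm]
        gcongr
        exact hblock c
    _ = ENNReal.ofReal (B * blockConst N k K) ^ 2 *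
        ∫⁻ c, ENNReal.ofReal (scale p c ^ N) * ∫⁻ ξ, ‖localized p F c ξ‖ₑ ^ 2 :=
        lintegral_const_mul' _ _ (by finiteness)
    _ ≤ _ := by
        exact mul_le_mul_right (lintegral_scale_mul_localized_le hp0 hp1 hFm) _

/-- The constant in the `L²` bound for the operator. -/
noncomputable def opConst (N k M : ℕ) (K : Set (Fin N → ℝ)) : ℝ :=
  2 * (24 ^ N * blockConst N k K + decayConst N M K * (∫⁻ ζ : Fin N → ℝ, decayKernel ζ).toReal)

theorem SymbolBound.eLpNorm_oscInt_le_opConst (ha : SymbolBound ρ δ B k K a) (hN : 1 ≤ N)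
    (hK : IsCompact K) (hp0 : 0 ≤ p) (hpρ : p ≤ ρ) (hρ1 : ρ ≤ 1) (hk : N ≤ (ρ - p) * k) {M : ℕ}
    (hM : M + (N + 1) ≤ k) (hδ : δ * (M + (N + 1) : ℕ) ≤ p * M) {F : (Fin N → ℝ) → ℂ}
    (hF : Integrable F) (hF2 : MemLp F 2) (hFm : Measurable F) :
    eLpNorm (oscInt a F) 2 volume ≤
      ENNReal.ofReal (opConst N k M K * B) * eLpNorm F 2 volume := by
  have hp1 := hpρ.trans hρ1
  have hB := ha.nonneg
  have hb : 0 ≤ blockConst N k K := by unfold blockConst; positivity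
  have hd : 0 ≤ decayConst N M K := by unfold decayConst; positivity
  obtain ⟨hu1, hu2⟩ := ha.integrable_oscInt hK hF
  rw [← eLpNorm_fourierT hu1 hu2]
  have hI : ∫⁻ ζ : Fin N → ℝ, decayKernel ζ =
      ENNReal.ofReal (∫⁻ ζ : Fin N → ℝ, decayKernel ζ).toReal :=
    (ENNReal.ofReal_toReal lintegral_decayKernel_lt_top.ne).symm
  have hnear := ha.lintegral_near_sq_le hK hp0 hpρ hρ1 hk hF hF2 hFm
  have hfar := lintegral_conv_sq_le measurable_decayKernel hFm.enorm
  rw [hI] at hfar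
  unfold opConst
  set I := (∫⁻ ζ : Fin N → ℝ, decayKernel ζ).toReal
  have hI0 : 0 ≤ I := ENNReal.toReal_nonneg
  set n : (Fin N → ℝ) → ℝ≥0∞ := fun η => ∫⁻ c, (nearSet p).indicator
    (fun q => ‖fourierT (oscInt a (localized p F q.1)) q.2‖ₑ) (c, η)
  set q : (Fin N → ℝ) → ℝ≥0∞ := fun η => ∫⁻ ξ, decayKernel (η - ξ) * ‖F ξ‖ₑ with hq
  have hqm : Measurable q := by
    have : Measurable fun r : (Fin N → ℝ) × (Fin N → ℝ) => decayKernel (r.1 - r.2) * ‖F r.2‖ₑ :=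
      (measurable_decayKernel.comp (by fun_prop)).mul (hFm.comp measurable_snd).enorm
    exact this.lintegral_prod_right'
  have hpt : ∀ η, ‖fourierT (oscInt a F) η‖ₑ ^ 2 ≤
      2 * n η ^ 2 + 2 * ENNReal.ofReal (B * decayConst N M K) ^ 2 * q η ^ 2 := by
    intro η
    have h := ha.enorm_fourierT_oscInt_le hN hK hp0 hp1 hM hδ hF hFm η
    have h2 := ENNReal.rpow_add_le_mul_rpow_add_rpow (n η)
      (ENNReal.ofReal (B * decayConst N M K) * q η) (p := 2) one_le_two
    norm_num at h2
    refine (pow_le_pow_left' h 2).trans (h2.trans_eq ?_)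
    ring
  have hsq : eLpNorm (fourierT (oscInt a F)) 2 volume ^ 2 ≤
      (ENNReal.ofReal (2 * (24 ^ N * blockConst N k K + decayConst N M K * I) * B) *
        eLpNorm F 2 volume) ^ 2 := by
    rw [mul_pow, eLpNorm_two_sq, eLpNorm_two_sq]
    refine (lintegral_mono hpt).trans ?_
    rw [lintegral_add_right _ ((hqm.pow_const 2).const_mul _),
      lintegral_const_mul' _ _ (by finiteness), lintegral_const_mul' _ _ (by finiteness)]
    have h24 : (1 : ℝ) ≤ 24 ^ N := one_le_pow₀ (by norm_num)
    calc _ ≤ 2 * (ENNReal.ofReal (24 ^ N) * (ENNReal.ofReal (B * blockConst N k K) ^ 2 *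
            ∫⁻ ξ, ‖F ξ‖ₑ ^ 2)) + 2 * ENNReal.ofReal (B * decayConst N M K) ^ 2 *
            (ENNReal.ofReal I ^ 2 * ∫⁻ ξ, ‖F ξ‖ₑ ^ 2) := by gcongr
      _ = ENNReal.ofReal (2 * (24 ^ N * (B * blockConst N k K) ^ 2) +
            2 * (B * decayConst N M K) ^ 2 * I ^ 2) * ∫⁻ ξ, ‖F ξ‖ₑ ^ 2 := by
          rw [ENNReal.ofReal_add (by positivity) (by positivity),
            ENNReal.ofReal_mul (p := 2) (by norm_num), ENNReal.ofReal_mul (p := 24 ^ N) (by positivity),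
            ENNReal.ofReal_mul (p := 2 * (B * decayConst N M K) ^ 2) (by positivity),
            ENNReal.ofReal_mul (p := 2) (by norm_num),
            ENNReal.ofReal_pow (p := B * blockConst N k K) (by positivity),
            ENNReal.ofReal_pow (p := B * decayConst N M K) (by positivity), ENNReal.ofReal_pow hI0,
            ENNReal.ofReal_ofNat 2]
          ring
      _ ≤ _ := by
          rw [← ENNReal.ofReal_pow (by positivity)]
          gcongr
          set b := blockConst N k K
          set d := decayConst N M K
          have h1 : (24 : ℝ) ^ N * b ^ 2 ≤ (24 ^ N * b) ^ 2 := by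
            rw [mul_pow]
            gcongr
            exact le_self_pow₀ h24 two_ne_zero
          have h2 : 0 ≤ 24 ^ N * b * (d * I) := by positivity
          have h3 : 2 * (24 ^ N * b ^ 2) + 2 * (d * I) ^ 2 ≤ (2 * (24 ^ N * b + d * I)) ^ 2 := by
            nlinarith [sq_nonneg (24 ^ N * b), sq_nonneg (d * I)]
          nlinarith [mul_le_mul_of_nonneg_right h3 (sq_nonneg B)]
  exact (ENNReal.pow_le_pow_left_iff two_ne_zero).1 hsq

end L2Bound

section Operator

variable {N : ℕ} {a b : (Fin N → ℝ) → (Fin N → ℝ) → ℂ} {ρ δ B : ℝ} {k : ℕ}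
  {K : Set (Fin N → ℝ)}

/-- Quantitative `L²` boundedness: the operator norm is controlled by finitely many symbol
seminorms. -/
theorem exists_eLpNorm_pdoApply_le (hN : 1 ≤ N) (hδ0 : 0 ≤ δ) (hδρ : δ < ρ) (hρ1 : ρ ≤ 1)
    (hK : IsCompact K) :
    ∃ (C : ℝ) (k : ℕ), 0 ≤ C ∧ ∀ (B : ℝ) (a : (Fin N → ℝ) → (Fin N → ℝ) → ℂ),
      SymbolBound ρ δ B k K a → ∀ f : SchwartzMap (Fin N → ℝ) ℂ, MemLp (pdoApply a f) 2 ∧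
        eLpNorm (pdoApply a f) 2 volume ≤ ENNReal.ofReal (C * B) * eLpNorm f 2 volume := by
  set p := (δ + ρ) / 2 with hp
  obtain ⟨M, hM⟩ := exists_nat_ge (δ * (N + 1) / (p - δ))
  obtain ⟨m, hm⟩ := exists_nat_ge (N / (ρ - p))
  rw [div_le_iff₀ (by linarith)] at hM hm
  refine ⟨opConst N (max (M + (N + 1)) m) M K, max (M + (N + 1)) m, ?_, fun B a ha f => ?_⟩
  · unfold opConst blockConst decayConst
    positivity
  · have hF := integrable_fourierT f
    have hFm := measurable_fourierT f.continuous
    have hPl := eLpNorm_fourierT f.integrable (f.memLp 2)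
    have hF2 : MemLp (fourierT f) 2 := ⟨hF.1, hPl.trans_lt (f.eLpNorm_lt_top 2 volume)⟩
    refine ⟨(ha.integrable_oscInt hK hF).2, ?_⟩
    have h := ha.eLpNorm_oscInt_le_opConst hN hK (p := p) (by linarith) (by linarith) hρ1 (by
      have : (m : ℝ) ≤ ((max (M + (N + 1)) m : ℕ) : ℝ) := by exact_mod_cast le_max_right _ _
      calc (N : ℝ) ≤ m * (ρ - p) := hm
        _ ≤ ((max (M + (N + 1)) m : ℕ) : ℝ) * (ρ - p) :=
          mul_le_mul_of_nonneg_right this (by linarith)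
        _ = _ := mul_comm _ _) (le_max_left _ m) (by push_cast; linarith) hF hF2 hFm
    rw [hPl] at h
    exact h

theorem fourierT_add (f g : SchwartzMap (Fin N → ℝ) ℂ) (ξ : Fin N → ℝ) :
    fourierT (f + g : SchwartzMap (Fin N → ℝ) ℂ) ξ = fourierT f ξ + fourierT g ξ := by
  have hi : ∀ h : SchwartzMap (Fin N → ℝ) ℂ, Integrable fun y : Fin N → ℝ =>
      Complex.exp (-(2 * (Real.pi : ℂ) * Complex.I * (dotProd y ξ : ℂ))) * h y := fun h => by
    refine h.integrable.bdd_mul (c := 1) ?_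
      (Eventually.of_forall fun y => (norm_exp_neg_dotProd _).le)
    unfold dotProd
    exact Continuous.aestronglyMeasurable (by fun_prop)
  unfold fourierT
  rw [← integral_add (hi f) (hi g)]
  simp [mul_add]

theorem fourierT_smul (c : ℂ) (f : SchwartzMap (Fin N → ℝ) ℂ) (ξ : Fin N → ℝ) :
    fourierT (c • f : SchwartzMap (Fin N → ℝ) ℂ) ξ = c * fourierT f ξ := by
  unfold fourierT
  rw [← integral_const_mul]
  simp [mul_left_comm]

theorem SymbolBound.integrable_pdoApply_integrand (ha : SymbolBound ρ δ B k K a)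
    (f : SchwartzMap (Fin N → ℝ) ℂ) (x : Fin N → ℝ) :
    Integrable fun ξ =>
      Complex.exp (2 * (Real.pi : ℂ) * Complex.I * (dotProd x ξ : ℂ)) * a x ξ * fourierT f ξ :=
  integrable_oscInt_integrand ha.continuous ha.norm_le (integrable_fourierT f) x

theorem SymbolBound.pdoApply_add (ha : SymbolBound ρ δ B k K a)
    (f g : SchwartzMap (Fin N → ℝ) ℂ) :
    pdoApply a (f + g : SchwartzMap (Fin N → ℝ) ℂ) = pdoApply a f + pdoApply a g := by
  funext x
  simp only [pdoApply, Pi.add_apply]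
  rw [← integral_add (ha.integrable_pdoApply_integrand f x) (ha.integrable_pdoApply_integrand g x)]
  simp only [fourierT_add, mul_add]

theorem pdoApply_smul (c : ℂ) (f : SchwartzMap (Fin N → ℝ) ℂ) :
    pdoApply a (c • f : SchwartzMap (Fin N → ℝ) ℂ) = c • pdoApply a f := by
  funext x
  simp only [pdoApply, Pi.smul_apply, smul_eq_mul]
  rw [← integral_const_mul]
  refine integral_congr_ae (Eventually.of_forall fun ξ => ?_)
  simp only [fourierT_smul]
  ring

theorem SymbolBound.pdoApply_sub {B' : ℝ} {k' : ℕ} (ha : SymbolBound ρ δ B k K a)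
    (hb : SymbolBound ρ δ B' k' K b) (f : SchwartzMap (Fin N → ℝ) ℂ) :
    pdoApply (fun x ξ => a x ξ - b x ξ) f = pdoApply a f - pdoApply b f := by
  funext x
  simp only [pdoApply, Pi.sub_apply]
  rw [← integral_sub (ha.integrable_pdoApply_integrand f x) (hb.integrable_pdoApply_integrand f x)]
  simp [mul_sub, sub_mul]

theorem denseRange_toLp :
    DenseRange (SchwartzMap.toLpCLM ℂ (E := Fin N → ℝ) ℂ 2 volume) :=
  SchwartzMap.denseRange_toLpCLM (E := Fin N → ℝ) (F := ℂ) (p := 2) ENNReal.ofNat_ne_top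

theorem norm_toLp_le_mul {u : (Fin N → ℝ) → ℂ} (hu : MemLp u 2) {C : ℝ} (hC : 0 ≤ C)
    {f : SchwartzMap (Fin N → ℝ) ℂ}
    (h : eLpNorm u 2 volume ≤ ENNReal.ofReal C * eLpNorm f 2 volume) :
    ‖hu.toLp u‖ ≤ C * ‖f.toLp 2 volume‖ := by
  rw [Lp.norm_toLp, SchwartzMap.norm_toLp]
  have hf : eLpNorm f 2 volume ≠ ⊤ := (f.eLpNorm_lt_top 2 volume).ne
  have hmono := ENNReal.toReal_mono (ENNReal.mul_ne_top ENNReal.ofReal_ne_top hf) h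
  rwa [ENNReal.toReal_mul, ENNReal.toReal_ofReal hC] at hmono

/-- The bounded extension to `L²` of a pseudodifferential operator. -/
theorem SymbolBound.exists_extension (ha : SymbolBound ρ δ B k K a) {C : ℝ} (hC : 0 ≤ C)
    (h : ∀ f : SchwartzMap (Fin N → ℝ) ℂ, MemLp (pdoApply a f) 2 ∧
      eLpNorm (pdoApply a f) 2 volume ≤ ENNReal.ofReal C * eLpNorm f 2 volume) :
    ∃ A : Lp ℂ 2 (volume : Measure (Fin N → ℝ)) →L[ℂ] Lp ℂ 2 (volume : Measure (Fin N → ℝ)),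
      ∀ f : SchwartzMap (Fin N → ℝ) ℂ, A (f.toLp 2 volume) = (h f).1.toLp (pdoApply a f) := by
  let S : SchwartzMap (Fin N → ℝ) ℂ →ₗ[ℂ] Lp ℂ 2 (volume : Measure (Fin N → ℝ)) :=
    { toFun := fun f => (h f).1.toLp (pdoApply a f)
      map_add' := fun f g => by
        rw [← MemLp.toLp_add]
        exact MemLp.toLp_congr _ _ (by rw [ha.pdoApply_add])
      map_smul' := fun c f => by
        rw [RingHom.id_apply, ← MemLp.toLp_const_smul]
        exact MemLp.toLp_congr _ _ (by rw [pdoApply_smul]) }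
  let e : SchwartzMap (Fin N → ℝ) ℂ →ₗ[ℂ] Lp ℂ 2 (volume : Measure (Fin N → ℝ)) :=
    (SchwartzMap.toLpCLM ℂ (E := Fin N → ℝ) ℂ 2 volume).toLinearMap
  exact ⟨S.extendOfNorm e, fun f => LinearMap.extendOfNorm_eq (f := S) (e := e) denseRange_toLp
    ⟨C, fun f => norm_toLp_le_mul (h f).1 hC (h f).2⟩ f⟩

theorem opNorm_le_of_schwartz
    (A : Lp ℂ 2 (volume : Measure (Fin N → ℝ)) →L[ℂ] Lp ℂ 2 (volume : Measure (Fin N → ℝ)))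
    {C : ℝ} (hC : 0 ≤ C)
    (h : ∀ f : SchwartzMap (Fin N → ℝ) ℂ, ‖A (f.toLp 2 volume)‖ ≤ C * ‖f.toLp 2 volume‖) :
    ‖A‖ ≤ C := by
  refine A.opNorm_le_bound hC fun g => ?_
  refine denseRange_toLp.induction_on (p := fun g => ‖A g‖ ≤ C * ‖g‖) g ?_ h
  exact isClosed_le (by fun_prop) (by fun_prop)

theorem SymbolBound.of_symbolDeriv (hB : 0 ≤ B) (hK : IsCompact K)
    (ha : ContDiff ℝ ∞ (Function.uncurry a)) (hs : ∀ x ∉ K, ∀ ξ, a x ξ = 0)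
    (h : ∀ Lx Lθ : List (Fin N), Lx.length ≤ k → Lθ.length ≤ k → ∀ x ∈ K, ∀ θ,
      ‖symbolDeriv Lx Lθ a x θ‖ ≤ B * jweight (0 - ρ * (Lθ.length : ℝ) + δ * (Lx.length : ℝ)) θ) :
    SymbolBound ρ δ B k K a where
  nonneg := hB
  smooth := ha
  supp := hs
  bound_theta L hL x θ := by
    by_cases hx : x ∈ K
    · simpa [jweight_eq, symbolDeriv] using h [] L (by simp) hL x hx θ
    · rw [foldr_pdTheta_eq_zero (hs x hx), norm_zero]
      have := jap_pos θ
      positivity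
  bound_x L hL x θ := by
    by_cases hx : x ∈ K
    · simpa [jweight_eq, symbolDeriv] using h L [] hL (by simp) x hx θ
    · rw [foldr_pdX_eq_zero hK.isClosed hs L x hx θ, norm_zero]
      have := jap_pos θ
      positivity

theorem IsHormanderSymbol.contDiff {m : ℝ} (ha : IsHormanderSymbol ρ δ m Set.univ a) :
    ContDiff ℝ ∞ (Function.uncurry a) := by
  have := ha.1
  rw [Set.univ_prod_univ, contDiffOn_univ] at this
  exact this

theorem finite_list_pairs (k : ℕ) :
    {q : List (Fin N) × List (Fin N) | q.1.length ≤ k ∧ q.2.length ≤ k}.Finite :=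
  ((List.finite_length_le (Fin N) k).prod (List.finite_length_le (Fin N) k)).subset fun _ h => h

theorem IsHormanderSymbol.exists_symbolBound (ha : IsHormanderSymbol ρ δ 0 Set.univ a)
    (hK : IsCompact K) (hs : ∀ x ∉ K, ∀ ξ, a x ξ = 0) (k : ℕ) : ∃ B, SymbolBound ρ δ B k K a := by
  choose c hc0 hc using ha.2 K (Set.subset_univ K) hK
  have hfin := finite_list_pairs (N := N) k
  refine ⟨∑ q ∈ hfin.toFinset, c q.1 q.2, .of_symbolDeriv
    (Finset.sum_nonneg fun q _ => hc0 _ _) hK ha.contDiff hs fun Lx Lθ hx hθ x hxK θ => ?_⟩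
  refine (hc Lx Lθ x hxK θ).trans ?_
  refine mul_le_mul_of_nonneg_right ?_ (by rw [jweight_eq]; have := jap_pos θ; positivity)
  exact Finset.single_le_sum (f := fun q => c q.1 q.2) (fun q _ => hc0 _ _)
    (hfin.mem_toFinset.2 (show (Lx, Lθ).1.length ≤ k ∧ (Lx, Lθ).2.length ≤ k from ⟨hx, hθ⟩))

theorem IsContinuousSymbolFamily.eventually_symbolBound {T : Type*} [TopologicalSpace T]
    {σ : T → (Fin N → ℝ) → (Fin N → ℝ) → ℂ} (hσ : IsContinuousSymbolFamily ρ δ 0 Set.univ σ)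
    (hK : IsCompact K) (hs : ∀ t, ∀ x ∉ K, ∀ ξ, σ t x ξ = 0) (k : ℕ) (t₀ : T) {ε : ℝ}
    (hε : 0 < ε) :
    ∀ᶠ t in nhds t₀, SymbolBound ρ δ ε k K fun x ξ => σ t x ξ - σ t₀ x ξ := by
  have h := (finite_list_pairs (N := N) k).eventually_all.2 fun q _ =>
    hσ.2 t₀ K (Set.subset_univ K) hK q.1 q.2 ε hε
  filter_upwards [h] with t ht
  refine .of_symbolDeriv hε.le hK ((hσ.1 t).contDiff.sub (hσ.1 t₀).contDiff)
    (fun x hx ξ => by rw [hs t x hx, hs t₀ x hx, sub_zero]) fun Lx Lθ hx hθ => ?_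
  exact ht (Lx, Lθ) ⟨hx, hθ⟩

end Operator

/-- Corollary "Abdd": for a continuous family `σ` over a compact space `T`
of order-zero symbols supported over a fixed compact set `K₀`, the bounded `L²`-extensions
`A t` of the operators `A_{σ t}` (characterized by agreeing with `A_{σ t}` on the
`L²`-classes of Schwartz functions) depend norm-continuously on `t`, and
`sup_{t ∈ T} ‖A t‖ < ∞`. -/
theorem pdo_family_norm_continuous_and_bounded
    {T : Type*} [TopologicalSpace T] [CompactSpace T] [T2Space T]
    {N : ℕ} (hN : 1 ≤ N)
    (ρ δ : ℝ) (hδ0 : 0 ≤ δ) (hδρ : δ < ρ) (hρ1 : ρ ≤ 1)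
    (σ : T → (Fin N → ℝ) → (Fin N → ℝ) → ℂ)
    (hσ : IsContinuousSymbolFamily ρ δ 0 Set.univ σ)
    (K₀ : Set (Fin N → ℝ)) (hK₀ : IsCompact K₀)
    (hσsupp : ∀ t : T, ∀ x : Fin N → ℝ, x ∉ K₀ → ∀ ξ : Fin N → ℝ, σ t x ξ = 0) :
    ∃ A : T → (Lp ℂ 2 (volume : Measure (Fin N → ℝ)) →L[ℂ]
        Lp ℂ 2 (volume : Measure (Fin N → ℝ))),
      (∀ t : T, ∀ f : SchwartzMap (Fin N → ℝ) ℂ,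
        ∀ g : Lp ℂ 2 (volume : Measure (Fin N → ℝ)),
          (⇑g =ᵐ[volume] ⇑f) → ⇑(A t g) =ᵐ[volume] pdoApply (σ t) ⇑f) ∧
      Continuous A ∧
      ∃ M : ℝ, ∀ t : T, ‖A t‖ ≤ M := by
  obtain ⟨C, k, hC, hbound⟩ := exists_eLpNorm_pdoApply_le hN hδ0 hδρ hρ1 hK₀
  choose B hB using fun t => (hσ.1 t).exists_symbolBound hK₀ (hσsupp t) k
  have hCB : ∀ t, 0 ≤ C * B t := fun t => mul_nonneg hC (hB t).nonneg
  choose A hA using fun t => (hB t).exists_extension (hCB t) (hbound (B t) (σ t) (hB t))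
  have hcont : Continuous A := by
    refine continuous_iff_continuousAt.2 fun t₀ => Metric.tendsto_nhds.2 fun ε hε => ?_
    have hε' : 0 < ε / (2 * (C + 1)) := by positivity
    filter_upwards [hσ.eventually_symbolBound hK₀ hσsupp k t₀ hε'] with t ht
    rw [dist_eq_norm]
    have hlt : C * (ε / (2 * (C + 1))) < ε := by
      rw [← mul_div_assoc, div_lt_iff₀ (by positivity)]
      nlinarith
    refine lt_of_le_of_lt (opNorm_le_of_schwartz _ (by positivity) fun f => ?_) hlt
    obtain ⟨h1, h2⟩ := hbound _ _ ht f
    have hd : (A t - A t₀) (f.toLp 2 volume) = h1.toLp _ := by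
      rw [sub_apply, hA, hA, ← MemLp.toLp_sub]
      exact MemLp.toLp_congr _ _ (by rw [(hB t).pdoApply_sub (hB t₀)])
    rw [hd]
    exact norm_toLp_le_mul h1 (by positivity) h2
  refine ⟨A, fun t f g hg => ?_, hcont, ?_⟩
  · have hgf : g = f.toLp 2 volume := Lp.ext (hg.trans (f.coeFn_toLp 2 volume).symm)
    rw [hgf, hA]
    exact MemLp.coeFn_toLp _
  · obtain ⟨M, hM⟩ := (isCompact_range hcont.norm).bddAbove
    exact ⟨M, fun t => hM ⟨t, rfl⟩⟩
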